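/- arXiv:1910.11321 — 3 statements merged into one kernel-verified Lean document; each statement's English description precedes it below -/
import Mathlib

section
/- Let n ≥ 3, let p ∈ ℝⁿ, r > 0, and let u be a real-valued harmonic function on the punctured open ball B_r(p) ∖ {p} ⊂ ℝⁿ. Suppose there exist s₀ ∈ (0, r), a constant C > 0 and an exponent μ ∈ (0, n−2) such that |u(x)| ≤ C·|x − p|^{−μ} for every x ∈ B_{s₀}(p) ∖ {p}. Then u extends to a harmonic function on all of B_r(p); that is, there exists a harmonic function ũ on B_r(p) with ũ = u on B_r(p) ∖ {p}. -/
/-- A real-valued function is harmonic on a set `s ⊆ ℝⁿ` if it is C² there and the sum of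
its pure second partial derivatives (computed within `s`) vanishes at every point of `s`. -/
def IsHarmonicOnEuc {n : ℕ} (u : EuclideanSpace ℝ (Fin n) → ℝ)
    (s : Set (EuclideanSpace ℝ (Fin n))) : Prop :=
  ContDiffOn ℝ 2 u s ∧
    ∀ x ∈ s, ∑ i : Fin n, iteratedFDerivWithin ℝ 2 u s x
      ![EuclideanSpace.single i 1, EuclideanSpace.single i 1] = 0

open MeasureTheory Filter Topology Metric

theorem rs_cont_mul {E : Type*} [TopologicalSpace E] {W : Set E} (hW : IsOpen W) {f g : E → ℝ}
    (hf : ContinuousOn f W) (hg : Continuous g) (hgW : tsupport g ⊆ W) :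
    Continuous (fun x => f x * g x) := by
  apply continuous_of_tsupport
  intro x hx
  have hx' : x ∈ tsupport g := closure_mono (fun y hy => by
    simp only [Function.mem_support] at hy ⊢; exact right_ne_zero_of_mul hy) hx
  exact (hf.continuousAt (hW.mem_nhds (hgW hx'))).mul hg.continuousAt

theorem rs_int_mul {n : ℕ} {W : Set (EuclideanSpace ℝ (Fin n))} (hW : IsOpen W)
    {f g : EuclideanSpace ℝ (Fin n) → ℝ}
    (hf : ContinuousOn f W) (hg : Continuous g) (hgc : HasCompactSupport g) (hgW : tsupport g ⊆ W) :
    Integrable (fun x => f x * g x) :=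
  (rs_cont_mul hW hf hg hgW).integrable_of_hasCompactSupport (hgc.mul_left)

theorem rs_tsupp {n : ℕ} (g : EuclideanSpace ℝ (Fin n) → ℝ) (e : EuclideanSpace ℝ (Fin n)) :
    tsupport (fun x => fderiv ℝ g x e) ⊆ tsupport g := by
  refine subset_trans (closure_mono ?_) (tsupport_fderiv_subset ℝ (f := g))
  intro y hy
  simp only [Function.mem_support] at hy ⊢
  intro h; apply hy; simp [h]

theorem rs_ibp {n : ℕ} {W : Set (EuclideanSpace ℝ (Fin n))} (hW : IsOpen W)
    {f g : EuclideanSpace ℝ (Fin n) → ℝ} (e : EuclideanSpace ℝ (Fin n))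
    (hf : ContDiffOn ℝ 2 f W) (hg : ContDiff ℝ 2 g) (hgc : HasCompactSupport g)
    (hgW : tsupport g ⊆ W) :
    ∫ x, f x * fderiv ℝ (fderiv ℝ g) x e e = ∫ x, fderiv ℝ (fderiv ℝ f) x e e * g x := by
  have hf' : ContDiffOn ℝ 1 (fderiv ℝ f) W := hf.fderiv_of_isOpen hW (by norm_num)
  have hg' : ContDiff ℝ 1 (fderiv ℝ g) := hg.fderiv_right (by norm_num)
  have hg1 : ContDiff ℝ 1 (fun x => fderiv ℝ g x e) := hg'.clm_apply contDiff_const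
  have hf1 : ContDiffOn ℝ 1 (fun x => fderiv ℝ f x e) W := hf'.clm_apply contDiffOn_const
  have hg2 : ∀ x, fderiv ℝ (fun x => fderiv ℝ g x e) x e = fderiv ℝ (fderiv ℝ g) x e e := by
    intro x
    rw [fderiv_clm_apply (hg'.differentiable (by norm_num) x) (by fun_prop)]
    simp
  have hf2 : ∀ x ∈ W, fderiv ℝ (fun x => fderiv ℝ f x e) x e = fderiv ℝ (fderiv ℝ f) x e e := by
    intro x hx
    rw [fderiv_clm_apply ((hf'.differentiableOn (by norm_num) x hx).differentiableAt
      (hW.mem_nhds hx)) (by fun_prop)]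
    simp
  have t1 := rs_tsupp g e
  have c1 : HasCompactSupport (fun x => fderiv ℝ g x e) := hgc.of_isClosed_subset
    (isClosed_tsupport _) t1
  have t2 : tsupport (fun x => fderiv ℝ (fun x => fderiv ℝ g x e) x e) ⊆ tsupport g :=
    (rs_tsupp _ e).trans t1
  have c2 : HasCompactSupport (fun x => fderiv ℝ (fun x => fderiv ℝ g x e) x e) :=
    hgc.of_isClosed_subset (isClosed_tsupport _) t2
  have k2 : Continuous (fun x => fderiv ℝ (fun x => fderiv ℝ g x e) x e) :=
    (hg1.continuous_fderiv (by norm_num)).clm_apply continuous_const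
  have kf2 : ContinuousOn (fun x => fderiv ℝ (fun x => fderiv ℝ f x e) x e) W :=
    (hf1.continuousOn_fderiv_of_isOpen hW (by norm_num)).clm_apply continuousOn_const
  calc ∫ x, f x * fderiv ℝ (fderiv ℝ g) x e e
      = ∫ x, f x * fderiv ℝ (fun x => fderiv ℝ g x e) x e := by simp_rw [hg2]
    _ = - ∫ x, fderiv ℝ f x e * fderiv ℝ g x e := by
        apply integral_mul_fderiv_eq_neg_fderiv_mul_of_integrable
        · exact rs_int_mul hW hf1.continuousOn hg1.continuous c1 (t1.trans hgW)
        · exact rs_int_mul hW hf.continuousOn k2 c2 (t2.trans hgW)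
        · exact rs_int_mul hW hf.continuousOn hg1.continuous c1 (t1.trans hgW)
        · intro x hx
          exact (hf.differentiableOn (by norm_num) x (hgW (t1 hx))).differentiableAt
            (hW.mem_nhds (hgW (t1 hx)))
        · intro x _
          exact hg1.differentiable (by norm_num) x
    _ = ∫ x, fderiv ℝ (fun x => fderiv ℝ f x e) x e * g x := by
        rw [integral_mul_fderiv_eq_neg_fderiv_mul_of_integrable, neg_neg]
        · exact rs_int_mul hW kf2 hg.continuous hgc hgW
        · exact rs_int_mul hW hf1.continuousOn hg1.continuous c1 (t1.trans hgW)
        · exact rs_int_mul hW hf1.continuousOn hg.continuous hgc hgW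
        · intro x hx
          exact (hf1.differentiableOn (by norm_num) x (hgW hx)).differentiableAt
            (hW.mem_nhds (hgW hx))
        · intro x _
          exact hg.differentiable (by norm_num) x
    _ = _ := by
        congr 1; ext x
        by_cases hx : x ∈ W
        · rw [hf2 x hx]
        · have : g x = 0 := image_eq_zero_of_notMem_tsupport (fun h => hx (hgW h))
          simp [this]

/-- Laplacian in coordinates -/
noncomputable def rsLap {n : ℕ} (f : EuclideanSpace ℝ (Fin n) → ℝ) (x : EuclideanSpace ℝ (Fin n)) : ℝ :=
  ∑ i : Fin n, iteratedFDeriv ℝ 2 f x ![EuclideanSpace.single i 1, EuclideanSpace.single i 1]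

theorem rsLap_congr {n : ℕ} {f g : EuclideanSpace ℝ (Fin n) → ℝ} {x : EuclideanSpace ℝ (Fin n)}
    (h : f =ᶠ[𝓝 x] g) : rsLap f x = rsLap g x := by
  unfold rsLap
  rw [(EventuallyEq.iteratedFDeriv ℝ h 2).eq_of_nhds]

theorem rsLap_zero_of_notMem {n : ℕ} {f : EuclideanSpace ℝ (Fin n) → ℝ} {x : EuclideanSpace ℝ (Fin n)}
    (h : x ∉ tsupport f) : rsLap f x = 0 := by
  rw [rsLap_congr (notMem_tsupport_iff_eventuallyEq.1 h)]
  simp [rsLap]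

theorem rsLap_cont {n : ℕ} {f : EuclideanSpace ℝ (Fin n) → ℝ} (hf : ContDiff ℝ 2 f) :
    Continuous (rsLap f) := by
  unfold rsLap
  refine continuous_finsetSum _ fun i _ => ?_
  have := hf.continuous_iteratedFDeriv (m := 2) (by norm_num)
  fun_prop

theorem rsLap_le {n : ℕ} (f : EuclideanSpace ℝ (Fin n) → ℝ) (x : EuclideanSpace ℝ (Fin n)) :
    |rsLap f x| ≤ n * ‖iteratedFDeriv ℝ 2 f x‖ := by
  unfold rsLap
  refine (Finset.abs_sum_le_sum_abs _ _).trans ?_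
  calc _ ≤ ∑ i : Fin n, ‖iteratedFDeriv ℝ 2 f x‖ := by
        refine Finset.sum_le_sum fun i _ => ?_
        rw [← Real.norm_eq_abs]
        refine (ContinuousMultilinearMap.le_opNorm _ _).trans ?_
        simp [Fin.prod_univ_two]
    _ = _ := by simp

theorem rsLap_sub {n : ℕ} {f g : EuclideanSpace ℝ (Fin n) → ℝ} (hf : ContDiff ℝ 2 f)
    (hg : ContDiff ℝ 2 g) (x : EuclideanSpace ℝ (Fin n)) :
    rsLap (fun y => f y - g y) x = rsLap f x - rsLap g x := by
  unfold rsLap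
  rw [← Finset.sum_sub_distrib]
  have : iteratedFDeriv ℝ 2 (fun y => f y - g y) x
    = iteratedFDeriv ℝ 2 f x - iteratedFDeriv ℝ 2 g x :=
    iteratedFDeriv_sub_apply hf.contDiffAt hg.contDiffAt
  simp [this]

theorem rs_scale {n : ℕ} {f : EuclideanSpace ℝ (Fin n) → ℝ} {k : ℕ} (hf : ContDiff ℝ k f)
    (a : ℝ) (p x : EuclideanSpace ℝ (Fin n)) :
    iteratedFDeriv ℝ k (fun y => f (a • (y - p))) x = a ^ k • iteratedFDeriv ℝ k f (a • (x - p)) := by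
  have h1 := iteratedFDeriv_comp_sub k p (f := fun z => f (a • z)) (𝕜 := ℝ) x
  rw [h1, iteratedFDeriv_comp_const_smul a hf]

theorem rsLap_scale {n : ℕ} {f : EuclideanSpace ℝ (Fin n) → ℝ} (hf : ContDiff ℝ 2 f)
    (a c : ℝ) (p x : EuclideanSpace ℝ (Fin n)) :
    rsLap (fun y => c * f (a • (y - p))) x = c * a ^ 2 * rsLap f (a • (x - p)) := by
  have hf' : ContDiff ℝ 2 (fun y => f (a • (y - p))) := by fun_prop
  have h1 : iteratedFDeriv ℝ 2 (fun y => c * f (a • (y - p))) x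
    = c • iteratedFDeriv ℝ 2 (fun y => f (a • (y - p))) x :=
    iteratedFDeriv_const_smul_apply (a := c) hf'.contDiffAt
  unfold rsLap
  rw [h1, rs_scale (by exact_mod_cast hf)]
  simp [Finset.mul_sum, mul_assoc]

theorem rs_green {n : ℕ} {W : Set (EuclideanSpace ℝ (Fin n))} (hW : IsOpen W)
    {f g : EuclideanSpace ℝ (Fin n) → ℝ}
    (hf : ContDiffOn ℝ 2 f W) (hg : ContDiff ℝ 2 g) (hgc : HasCompactSupport g)
    (hgW : tsupport g ⊆ W) (h0 : ∀ x ∈ W, rsLap f x = 0) :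
    ∫ x, f x * rsLap g x = 0 := by
  have key : ∀ x, ∀ e : EuclideanSpace ℝ (Fin n), ∀ f : EuclideanSpace ℝ (Fin n) → ℝ,
    iteratedFDeriv ℝ 2 f x ![e, e] = fderiv ℝ (fderiv ℝ f) x e e := by
    intro x e f; simp [iteratedFDeriv_two_apply]
  have hf' : ContDiffOn ℝ 1 (fderiv ℝ f) W := hf.fderiv_of_isOpen hW (by norm_num)
  have hg' : ContDiff ℝ 1 (fderiv ℝ g) := hg.fderiv_right (by norm_num)
  simp only [rsLap, Finset.mul_sum, key] at h0 ⊢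
  rw [integral_finsetSum]
  · simp_rw [rs_ibp hW _ hf hg hgc hgW]
    rw [← integral_finsetSum]
    · rw [integral_eq_zero_of_ae]
      refine Eventually.of_forall fun x => ?_
      simp only [← Finset.sum_mul, Pi.zero_apply]
      by_cases hx : x ∈ W
      · simp [h0 x hx]
      · have : g x = 0 := image_eq_zero_of_notMem_tsupport (fun h => hx (hgW h))
        simp [this]
    · intro i _
      exact rs_int_mul hW (((hf'.continuousOn_fderiv_of_isOpen hW (by norm_num)).clm_apply
        continuousOn_const).clm_apply continuousOn_const) hg.continuous hgc hgW
  · intro i _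
    have t : tsupport (fun x => fderiv ℝ (fderiv ℝ g) x (EuclideanSpace.single i 1)
        (EuclideanSpace.single i 1)) ⊆ tsupport g := by
      refine subset_trans (closure_mono ?_) ((tsupport_fderiv_subset ℝ (f := fderiv ℝ g)).trans
        (tsupport_fderiv_subset ℝ (f := g)))
      intro y hy
      simp only [Function.mem_support] at hy ⊢
      intro h; apply hy; simp [h]
    exact rs_int_mul hW hf.continuousOn (((hg'.continuous_fderiv (by norm_num)).clm_apply
        continuous_const).clm_apply continuous_const) (hgc.of_isClosed_subset
        (isClosed_tsupport _) t) (t.trans hgW)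

theorem rs_cutoff (n : ℕ) : ∃ χ : EuclideanSpace ℝ (Fin n) → ℝ, ContDiff ℝ 2 χ ∧
    (∀ z, ‖z‖ ≤ 1 → χ z = 0) ∧ (∀ z, 2 ≤ ‖z‖ → χ z = 1) ∧
    ∃ M : ℕ → ℝ, ∀ i ≤ 2, ∀ z, ‖z‖ ^ i * ‖iteratedFDeriv ℝ i χ z‖ ≤ M i := by
  let b : ContDiffBump (0 : EuclideanSpace ℝ (Fin n)) := ⟨1, 2, by norm_num, by norm_num⟩
  have hb : ContDiff ℝ 2 (b : EuclideanSpace ℝ (Fin n) → ℝ) := b.contDiff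
  have hbd : ∀ i : ℕ, ∃ M : ℝ, i ≤ 2 → ∀ z, ‖z‖ ^ i * ‖iteratedFDeriv ℝ i (fun x => 1 - b x) z‖ ≤ M := by
    intro i
    by_cases hi : i ≤ 2
    swap
    · exact ⟨0, fun h => absurd h hi⟩
    have hi' : (i : WithTop ℕ∞) ≤ 2 := by exact_mod_cast hi
    have hc : Continuous (fun z => ‖z‖ ^ i * ‖iteratedFDeriv ℝ i b z‖) :=
      (continuous_norm.pow i).mul (hb.continuous_iteratedFDeriv hi').norm
    have hs : HasCompactSupport (fun z => ‖z‖ ^ i * ‖iteratedFDeriv ℝ i b z‖) :=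
      ((b.hasCompactSupport.iteratedFDeriv (𝕜 := ℝ) i).norm).mul_left
    obtain ⟨M, hM⟩ := hs.exists_bound_of_continuous hc
    refine ⟨1 + M, fun _ z => ?_⟩
    have e : iteratedFDeriv ℝ i (fun x => 1 - b x) z
      = iteratedFDeriv ℝ i (fun _ => (1:ℝ)) z - iteratedFDeriv ℝ i b z :=
      iteratedFDeriv_sub_apply (by fun_prop) (hb.of_le hi').contDiffAt
    have h1 : ‖z‖ ^ i * ‖iteratedFDeriv ℝ i (fun _ => (1:ℝ)) z‖ ≤ 1 := by
      rcases Nat.eq_zero_or_pos i with h | h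
      · subst h; simp
      · rw [iteratedFDeriv_const_of_ne h.ne']; simp
    have h2 := (le_abs_self _).trans (hM z)
    rw [e]
    calc _ ≤ ‖z‖ ^ i * (‖iteratedFDeriv ℝ i (fun _ => (1:ℝ)) z‖ + ‖iteratedFDeriv ℝ i b z‖) := by
          gcongr; exact norm_sub_le _ _
      _ ≤ _ := by rw [mul_add]; linarith
  choose M hM using hbd
  refine ⟨fun x => 1 - b x, contDiff_const.sub hb, ?_, ?_, M, fun i hi z => hM i hi z⟩
  · intro z hz
    beta_reduce
    rw [b.one_of_mem_closedBall (by simpa using hz)]; simp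
  · intro z hz
    beta_reduce
    rw [b.zero_of_le_dist (by simpa using hz)]; simp

theorem rs_intbound {n : ℕ} (hn : 1 ≤ n) (p : EuclideanSpace ℝ (Fin n)) (s α K : ℝ) (hα : α < n) :
    Integrable (fun x => (ball p s).indicator (fun x => K * ‖x - p‖ ^ (-α)) x) := by
  have h : IntegrableOn (fun x : EuclideanSpace ℝ (Fin n) => K * ‖x‖ ^ (-α)) (ball 0 s) := by
    refine integrableOn_ball_of_norm_le_rpow (C := |K|) (α := α) (by simpa using hn) (by simpa using hα) ?_ ?_
    · refine Eventually.of_forall fun x => ?_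
      rw [norm_mul, Real.norm_eq_abs, Real.norm_eq_abs, abs_of_nonneg (Real.rpow_nonneg (norm_nonneg x) _)]
    · exact (by fun_prop : Measurable (fun x : EuclideanSpace ℝ (Fin n) => K * ‖x‖ ^ (-α))).aestronglyMeasurable
  rw [← integrable_indicator_iff measurableSet_ball] at h
  convert h.comp_sub_right p using 2 with x
  by_cases hx : x ∈ ball p s
  · have : x - p ∈ ball (0 : EuclideanSpace ℝ (Fin n)) s := by simpa [dist_eq_norm] using hx
    rw [Set.indicator_of_mem hx, Set.indicator_of_mem this]
  · have : x - p ∉ ball (0 : EuclideanSpace ℝ (Fin n)) s := by simpa [dist_eq_norm] using hx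
    rw [Set.indicator_of_notMem hx, Set.indicator_of_notMem this]

theorem rs_meas {n : ℕ} {W : Set (EuclideanSpace ℝ (Fin n))} (hW : IsOpen W)
    {f : EuclideanSpace ℝ (Fin n) → ℝ} (hf : ContinuousOn f W) (hf0 : ∀ x ∉ W, f x = 0) :
    AEStronglyMeasurable f volume := by
  have h := hf.aestronglyMeasurable (μ := volume) hW.measurableSet
  rw [← aestronglyMeasurable_indicator_iff hW.measurableSet] at h
  have heq : W.indicator f = f := by
    ext x
    by_cases hx : x ∈ W
    · rw [Set.indicator_of_mem hx]
    · rw [Set.indicator_of_notMem hx, hf0 x hx]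
  rwa [heq] at h

theorem rs_measurable {n : ℕ} {W : Set (EuclideanSpace ℝ (Fin n))} (hW : IsOpen W)
    {f : EuclideanSpace ℝ (Fin n) → ℝ} (hf : ContinuousOn f W) (hf0 : ∀ x ∉ W, f x = 0) :
    Measurable f := by
  classical
  have h := hf.measurable_piecewise (g := fun _ => (0:ℝ)) continuousOn_const hW.measurableSet
  have heq : W.piecewise f (fun _ => 0) = f := by
    ext x
    by_cases hx : x ∈ W
    · simp [hx]
    · simp [hx, hf0 x hx]
  rwa [heq] at h

theorem rs_weak {n : ℕ} (hn : 1 ≤ n) (p : EuclideanSpace ℝ (Fin n)) (s C μ : ℝ) (hs : 0 < s)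
    (hC : 0 < C) (hμ : μ + 2 < n)
    {f : EuclideanSpace ℝ (Fin n) → ℝ} (hf : ContDiffOn ℝ 2 f (ball p s \ {p}))
    (h0 : ∀ x ∈ ball p s \ {p}, rsLap f x = 0) (hf0 : ∀ x ∉ ball p s \ {p}, f x = 0)
    (hb : ∀ x ∈ ball p s \ {p}, |f x| ≤ C * ‖x - p‖ ^ (-μ))
    {φ : EuclideanSpace ℝ (Fin n) → ℝ} (hφ : ContDiff ℝ 2 φ) (hφc : HasCompactSupport φ)
    (hφs : tsupport φ ⊆ ball p s) :
    ∫ x, f x * rsLap φ x = 0 := by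
  have hW : IsOpen (ball p s \ {p}) := isOpen_ball.sdiff isClosed_singleton
  obtain ⟨χ, hχ, hχ0, hχ1, M, hM⟩ := rs_cutoff n
  have hA : ∀ i : ℕ, ∃ A : ℝ, 0 ≤ A ∧ (i ≤ 2 → ∀ z, ‖iteratedFDeriv ℝ i φ z‖ ≤ A) := by
    intro i
    by_cases hi : i ≤ 2
    · obtain ⟨A, hA⟩ := (hφc.iteratedFDeriv (𝕜 := ℝ) i).exists_bound_of_continuous
        (hφ.continuous_iteratedFDeriv (by exact_mod_cast hi))
      exact ⟨A, (norm_nonneg _).trans (hA 0), fun _ => hA⟩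
    · exact ⟨0, le_rfl, fun h => absurd h hi⟩
  choose A hA0 hA using hA
  have hM0 : ∀ i ≤ 2, 0 ≤ M i := fun i hi => le_trans (by positivity) (hM i hi 0)
  set a : ℕ → ℝ := fun k => (k : ℝ) + 1 with ha
  have hapos : ∀ k, 0 < a k := fun k => by positivity
  set ψ : ℕ → EuclideanSpace ℝ (Fin n) → ℝ := fun k x => φ x * χ (a k • (x - p)) with hψ
  have hχk : ∀ k, ContDiff ℝ 2 (fun x => χ (a k • (x - p))) := fun k => by fun_prop
  have hψd : ∀ k, ContDiff ℝ 2 (ψ k) := fun k => hφ.mul (hχk k)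
  have hψt : ∀ k, tsupport (ψ k) ⊆ tsupport φ := fun k => closure_mono (fun y hy => by
    simp only [Function.mem_support, hψ] at hy ⊢; exact left_ne_zero_of_mul hy)
  have hψc : ∀ k, HasCompactSupport (ψ k) := fun k => hφc.of_isClosed_subset
    (isClosed_tsupport _) (hψt k)
  have hψp : ∀ k, p ∉ tsupport (ψ k) := by
    intro k
    rw [notMem_tsupport_iff_eventuallyEq]
    have : ∀ᶠ y in 𝓝 p, ‖a k • (y - p)‖ < 1 := by
      have hc : ContinuousAt (fun y => ‖a k • (y - p)‖) p := by fun_prop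
      exact hc.eventually_lt continuousAt_const (by simp)
    filter_upwards [this] with y hy
    simp [hψ, hχ0 _ hy.le]
  have hint0 : ∀ k, ∫ x, f x * rsLap (ψ k) x = 0 := fun k =>
    rs_green hW hf (hψd k) (hψc k) (fun x hx => ⟨hφs (hψt k hx), fun h => hψp k (h ▸ hx)⟩) h0
  set K : ℝ := ∑ i ∈ Finset.range 3, ((2:ℕ).choose i : ℝ) * A i * (M (2 - i) * s ^ i) with hK
  have hbound2 : ∀ k, ∀ x ∈ ball p s \ {p}, ‖iteratedFDeriv ℝ 2 (ψ k) x‖ ≤ K * ‖x - p‖ ^ (-2 : ℝ) := by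
    intro k x hx
    have hd : 0 < ‖x - p‖ := norm_pos_iff.2 (sub_ne_zero.2 hx.2)
    have hds : ‖x - p‖ ≤ s := by have := hx.1; rw [mem_ball, dist_eq_norm] at this; exact this.le
    refine (norm_iteratedFDeriv_mul_le hφ (hχk k) x (n := 2) (by norm_num)).trans ?_
    rw [hK, Finset.sum_mul]
    refine Finset.sum_le_sum fun i hi => ?_
    have hi2 : i ≤ 2 := by simp at hi; omega
    rw [mul_assoc (_ * A i)]
    have hC2 : ‖iteratedFDeriv ℝ (2 - i) (fun x => χ (a k • (x - p))) x‖
        ≤ M (2 - i) * s ^ i * ‖x - p‖ ^ (-2 : ℝ) := by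
      have hχi : ContDiff ℝ ((2 - i : ℕ) : WithTop ℕ∞) χ := hχ.of_le (by
        have : 2 - i ≤ 2 := by omega
        exact_mod_cast this)
      rw [rs_scale hχi, norm_smul, norm_pow, Real.norm_of_nonneg (hapos k).le]
      have h3 := hM (2 - i) (by omega) (a k • (x - p))
      rw [norm_smul, Real.norm_of_nonneg (hapos k).le, mul_pow] at h3
      rw [Real.rpow_neg hd.le, ← div_eq_mul_inv, le_div_iff₀ (by positivity)]
      have h4 : ‖x - p‖ ^ (2:ℝ) = ‖x - p‖ ^ (2 - i) * ‖x - p‖ ^ i := by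
        rw [← pow_add, Nat.sub_add_cancel hi2]; norm_cast
      rw [h4]
      calc _ = (a k ^ (2 - i) * ‖x - p‖ ^ (2 - i) * ‖iteratedFDeriv ℝ (2 - i) χ (a k • (x - p))‖) * ‖x - p‖ ^ i := by ring
        _ ≤ M (2 - i) * ‖x - p‖ ^ i := by gcongr
        _ ≤ M (2 - i) * s ^ i := by
          have := hM0 (2 - i) (by omega)
          gcongr
    have := hA0 i
    gcongr
    exact hA i hi2 x
  have hDCT := tendsto_integral_of_dominated_convergence (μ := volume)
    (F := fun k x => f x * rsLap (ψ k) x) (f := fun x => f x * rsLap φ x)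
    (fun x => (ball p s).indicator (fun x => (C * (n * K)) * ‖x - p‖ ^ (-(μ + 2))) x)
    (fun k => (rs_meas hW hf.continuousOn hf0).mul (rsLap_cont (hψd k)).aestronglyMeasurable)
    (rs_intbound hn p s (μ + 2) _ hμ)
    (fun k => by
      refine Eventually.of_forall fun x => ?_
      by_cases hx : x ∈ ball p s \ {p}
      · rw [Set.indicator_of_mem hx.1, norm_mul, Real.norm_eq_abs, Real.norm_eq_abs]
        have hd : 0 < ‖x - p‖ := norm_pos_iff.2 (sub_ne_zero.2 hx.2)
        calc _ ≤ (C * ‖x - p‖ ^ (-μ)) * (n * (K * ‖x - p‖ ^ (-2 : ℝ))) := by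
              gcongr
              · exact hb x hx
              · exact (rsLap_le _ _).trans (by gcongr; exact hbound2 k x hx)
          _ = _ := by
              rw [neg_add, Real.rpow_add hd]; ring
      · rw [hf0 x hx]
        by_cases hx1 : x ∈ ball p s
        · have hxp : x = p := by by_contra h; exact hx ⟨hx1, h⟩
          subst hxp
          rw [Set.indicator_of_mem hx1]
          simp only [zero_mul, norm_zero]
          have : 0 ≤ K := Finset.sum_nonneg fun i hi => by
            have := hA0 i
            have := hM0 (2 - i) (by omega)
            positivity
          positivity
        · rw [Set.indicator_of_notMem hx1]; simp)
    (by
      refine Eventually.of_forall fun x => ?_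
      by_cases hx : x = p
      · have : f x = 0 := hf0 x (fun h => h.2 hx)
        simp [this]
      · have hd : 0 < ‖x - p‖ := norm_pos_iff.2 (sub_ne_zero.2 hx)
        refine tendsto_const_nhds.congr' ?_
        have : Tendsto a atTop atTop := tendsto_atTop_add_const_right _ _ tendsto_natCast_atTop_atTop
        filter_upwards [this.eventually_gt_atTop (2 / ‖x - p‖)] with k hk
        congr 1
        apply rsLap_congr
        rw [div_lt_iff₀ hd] at hk
        have : ∀ᶠ y in 𝓝 x, 2 < ‖a k • (y - p)‖ := by
          have hc : ContinuousAt (fun y => ‖a k • (y - p)‖) x := by fun_prop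
          exact continuousAt_const.eventually_lt hc (by
            rw [norm_smul, Real.norm_of_nonneg (hapos k).le]; exact hk)
        filter_upwards [this] with y hy
        simp [hψ, hχ1 _ hy.le])
  simp only [hint0] at hDCT
  exact (tendsto_nhds_unique hDCT tendsto_const_nhds)

theorem rs_radial {n : ℕ} {g g1 g2 : ℝ → ℝ} (h1 : ∀ t, HasDerivAt g (g1 t) t)
    (h2 : ∀ t, HasDerivAt g1 (g2 t) t) (z : EuclideanSpace ℝ (Fin n))
    (hG : ContDiff ℝ 2 (fun z : EuclideanSpace ℝ (Fin n) => g (‖z‖ ^ 2))) :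
    rsLap (fun z => g (‖z‖ ^ 2)) z = 4 * ‖z‖ ^ 2 * g2 (‖z‖ ^ 2) + 2 * n * g1 (‖z‖ ^ 2) := by
  have hsq : ∀ y : EuclideanSpace ℝ (Fin n), HasFDerivAt (fun y => ‖y‖ ^ 2) (2 • innerSL ℝ y) y :=
    fun y => (hasStrictFDerivAt_norm_sq y).hasFDerivAt
  have d1 : ∀ y e : EuclideanSpace ℝ (Fin n), fderiv ℝ (fun z => g (‖z‖ ^ 2)) y e
      = g1 (‖y‖ ^ 2) * (2 * inner ℝ y e) := by
    intro y e
    have := (h1 (‖y‖ ^ 2)).comp_hasFDerivAt y (hsq y)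
    rw [HasFDerivAt.fderiv (f := fun z => g (‖z‖ ^ 2)) this]
    simp
  have d2 : ∀ e : EuclideanSpace ℝ (Fin n), iteratedFDeriv ℝ 2 (fun z => g (‖z‖ ^ 2)) z ![e, e]
      = 4 * g2 (‖z‖ ^ 2) * (inner ℝ z e) ^ 2 + 2 * g1 (‖z‖ ^ 2) * ‖e‖ ^ 2 := by
    intro e
    have hg' : ContDiff ℝ 1 (fderiv ℝ (fun z : EuclideanSpace ℝ (Fin n) => g (‖z‖ ^ 2))) :=
      hG.fderiv_right (by norm_num)
    have e1 : fderiv ℝ (fun x => fderiv ℝ (fun z => g (‖z‖ ^ 2)) x e) z e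
        = fderiv ℝ (fderiv ℝ (fun z => g (‖z‖ ^ 2))) z e e := by
      rw [fderiv_clm_apply (hg'.differentiable (by norm_num) z) (by fun_prop)]
      simp
    rw [iteratedFDeriv_two_apply]
    simp only [Matrix.cons_val_zero, Matrix.cons_val_one]
    rw [← e1]
    simp only [d1]
    have a1 := (h2 (‖z‖ ^ 2)).comp_hasFDerivAt z (hsq z)
    have a2 : HasFDerivAt (fun y : EuclideanSpace ℝ (Fin n) => 2 * inner ℝ y e)
        ((2:ℝ) • innerSL ℝ e) z := by
      have := ((innerSL ℝ e).hasFDerivAt (x := z)).const_mul (2:ℝ)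
      refine this.congr_of_eventuallyEq (Eventually.of_forall fun y => ?_)
      simp [real_inner_comm]
    rw [HasFDerivAt.fderiv (f := fun y => g1 (‖y‖ ^ 2) * (2 * inner ℝ y e)) (a1.mul a2)]
    simp
    ring
  unfold rsLap
  simp only [d2, Finset.sum_add_distrib, ← Finset.mul_sum]
  have s1 : ∑ i : Fin n, (inner ℝ z (EuclideanSpace.single i (1:ℝ))) ^ 2 = ‖z‖ ^ 2 := by
    rw [EuclideanSpace.norm_sq_eq]
    simp [EuclideanSpace.inner_single_right]
  rw [s1]
  simp
  ring

theorem rs_kernel {n : ℕ} (hn : 3 ≤ n) : ∃ (G : EuclideanSpace ℝ (Fin n) → ℝ) (a : ℝ),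
    ContDiff ℝ 4 G ∧ (∀ z, 2 ≤ ‖z‖ → G z = a * ‖z‖ ^ (2 - n : ℝ)) ∧
    (∀ z, 2 ≤ ‖z‖ → rsLap G z = 0) ∧ ∫ z, rsLap G z ≠ 0 := by
  set N : ℝ := (n : ℝ) / 2 with hN
  have hN1 : 1 < N := by
    have : (3:ℝ) ≤ n := by exact_mod_cast hn
    rw [hN]; linarith
  set h : ℝ → ℝ := fun t => Real.smoothTransition (t - 1) with hh
  have hhd : ContDiff ℝ 4 h := (Real.smoothTransition.contDiff (n := 4)).comp (contDiff_id.sub contDiff_const)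
  have h0 : ∀ t ≤ 1, h t = 0 := fun t ht => Real.smoothTransition.zero_of_nonpos (by linarith)
  have h1 : ∀ t, 2 ≤ t → h t = 1 := fun t ht => Real.smoothTransition.one_of_one_le (by linarith)
  have hmono : Monotone h := fun x y hxy => Real.smoothTransition.monotone (by linarith)
  have hh' : ∀ t, HasDerivAt h (deriv h t) t := fun t => (hhd.differentiable (by norm_num) t).hasDerivAt
  set k : ℝ → ℝ := fun t => h t * t ^ (-N) with hk
  have hkd : ContDiff ℝ 4 k := by
    rw [contDiff_iff_contDiffAt]
    intro t
    by_cases ht : t < 1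
    · have : k =ᶠ[𝓝 t] fun _ => 0 := by
        filter_upwards [Iio_mem_nhds ht] with y hy
        simp [hk, h0 y (le_of_lt hy)]
      exact contDiffAt_const.congr_of_eventuallyEq this
    · exact hhd.contDiffAt.mul (Real.contDiffAt_rpow_const_of_ne (by linarith))
  set a : ℝ := 1 / (N - 1) with ha
  set g : ℝ → ℝ := fun t => a * 2 ^ (1 - N) - ∫ x in (2:ℝ)..t, k x with hg
  have hg1 : ∀ t, HasDerivAt g (-k t) t := by
    intro t
    have := (hkd.continuous.integral_hasStrictDerivAt 2 t).hasDerivAt.const_sub (a * 2 ^ (1 - N))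
    exact this
  have hg2 : ∀ t, HasDerivAt (fun t => -k t) (-deriv k t) t := fun t =>
    (hkd.differentiable (by norm_num) t).hasDerivAt.neg
  have hgd : ContDiff ℝ 4 g := by
    have : ContDiff ℝ (3 + 1) g := by
      rw [contDiff_succ_iff_deriv]
      refine ⟨fun t => (hg1 t).differentiableAt, by simp, ?_⟩
      have : deriv g = fun t => -k t := funext fun t => (hg1 t).deriv
      rw [this]
      exact (hkd.of_le (by norm_num)).neg
    convert this using 1
    norm_num
  have hG : ContDiff ℝ 4 (fun z : EuclideanSpace ℝ (Fin n) => g (‖z‖ ^ 2)) :=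
    hgd.comp (contDiff_norm_sq ℝ)
  have hlap : ∀ z : EuclideanSpace ℝ (Fin n), rsLap (fun z => g (‖z‖ ^ 2)) z
      = -(4 * (‖z‖ ^ 2 * (‖z‖ ^ 2) ^ (-N)) * deriv h (‖z‖ ^ 2)) := by
    intro z
    rw [rs_radial hg1 hg2 z (hG.of_le (by norm_num))]
    rcases (sq_nonneg ‖z‖).eq_or_lt with hz | hz
    · rw [← hz]
      simp [hk, h0 0 (by norm_num)]
    · set t := ‖z‖ ^ 2
      have hkt : deriv k t = deriv h t * t ^ (-N) + h t * (-N * t ^ (-N - 1)) :=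
        ((hh' t).mul (Real.hasDerivAt_rpow_const (Or.inl hz.ne'))).deriv
      rw [hkt, Real.rpow_sub_one hz.ne', hk, show (n:ℝ) = 2 * N by rw [hN]; ring]
      field_simp
      ring
  have hdpos : ∀ t, 0 ≤ deriv h t := fun t => hmono.deriv_nonneg
  have hdz : ∀ t, 2 < t → deriv h t = 0 := by
    intro t ht
    have : h =ᶠ[𝓝 t] fun _ => 1 := by
      filter_upwards [Ioi_mem_nhds ht] with y hy
      exact h1 y (le_of_lt hy)
    rw [this.deriv_eq]; simp
  have hsupp : ∀ z : EuclideanSpace ℝ (Fin n), 2 ≤ ‖z‖ → rsLap (fun z => g (‖z‖ ^ 2)) z = 0 := by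
    intro z hz
    rw [hlap, hdz _ (by nlinarith)]; simp
  refine ⟨fun z => g (‖z‖ ^ 2), a, hG, ?_, hsupp, ?_⟩
  · intro z hz
    have ht : (2:ℝ) ≤ ‖z‖ ^ 2 := by nlinarith
    have e1 : ∫ x in (2:ℝ)..(‖z‖ ^ 2), k x = ∫ x in (2:ℝ)..(‖z‖ ^ 2), x ^ (-N) := by
      apply intervalIntegral.integral_congr
      intro x hx
      rw [Set.uIcc_of_le ht] at hx
      simp [hk, h1 x hx.1]
    have e2 : ∫ x in (2:ℝ)..(‖z‖ ^ 2), x ^ (-N) = ((‖z‖ ^ 2) ^ (-N + 1) - 2 ^ (-N + 1)) / (-N + 1) := by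
      apply integral_rpow
      right
      refine ⟨by linarith, ?_⟩
      rw [Set.uIcc_of_le ht]
      intro h; linarith [h.1]
    have e3 : (‖z‖ ^ 2) ^ (-N + 1) = ‖z‖ ^ (2 - n : ℝ) := by
      rw [← Real.rpow_natCast, ← Real.rpow_mul (norm_nonneg z)]
      congr 1
      rw [hN]; push_cast; ring
    have hne : N - 1 ≠ 0 := by linarith
    have hne' : -N + 1 ≠ 0 := by linarith
    simp only [hg]
    rw [e1, e2, e3, ha, show 1 - N = -N + 1 by ring, show N - 1 = -(-N + 1) by ring]
    field_simp
    ring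
  · have hc : Continuous (fun z : EuclideanSpace ℝ (Fin n) => - rsLap (fun z => g (‖z‖ ^ 2)) z) :=
      (rsLap_cont (hG.of_le (by norm_num))).neg
    have hcs : HasCompactSupport (fun z : EuclideanSpace ℝ (Fin n) => - rsLap (fun z => g (‖z‖ ^ 2)) z) := by
      refine HasCompactSupport.of_support_subset_isCompact (isCompact_closedBall 0 2) ?_
      intro z hz
      by_contra hz'
      apply hz
      simp only [neg_eq_zero]
      apply hsupp
      simp at hz'
      exact hz'.le
    have hnn : 0 ≤ (fun z : EuclideanSpace ℝ (Fin n) => - rsLap (fun z => g (‖z‖ ^ 2)) z) := by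
      intro z
      simp only [hlap, neg_neg, Pi.zero_apply]
      have := hdpos (‖z‖ ^ 2)
      positivity
    have hnz : (fun z : EuclideanSpace ℝ (Fin n) => - rsLap (fun z => g (‖z‖ ^ 2)) z) ≠ 0 := by
      intro hzero
      obtain ⟨c, hc, hc'⟩ := exists_hasDerivAt_eq_slope h (deriv h) (by norm_num : (1:ℝ) < 2)
        hhd.continuous.continuousOn (fun x _ => hh' x)
      rw [h0 1 le_rfl, h1 2 le_rfl] at hc'
      have hcpos : 0 < c := by linarith [hc.1]
      let i : Fin n := ⟨0, by omega⟩
      have := congrFun hzero (EuclideanSpace.single i (√c))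
      simp only [hlap, neg_neg, Pi.zero_apply] at this
      have hnorm : ‖EuclideanSpace.single i (√c)‖ ^ 2 = c := by
        simp [Real.sq_sqrt hcpos.le]
      rw [hnorm, hc'] at this
      have : 0 < c ^ (-N) := by positivity
      norm_num at *
      rcases ‹_ ∨ _› with h | h <;> linarith
    obtain ⟨z, hz⟩ := Function.ne_iff.1 hnz
    have := hc.integral_pos_of_hasCompactSupport_nonneg_nonzero hcs hnn hz (μ := volume)
    rw [integral_neg] at this
    intro h; rw [h] at this; simp at this

theorem rsLap_contDiff {n : ℕ} {G : EuclideanSpace ℝ (Fin n) → ℝ} (hG : ContDiff ℝ 4 G) :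
    ContDiff ℝ 2 (rsLap G) := by
  unfold rsLap
  have h1 : ContDiff ℝ 3 (fderiv ℝ G) := hG.fderiv_right (by norm_num)
  have h2 : ContDiff ℝ 2 (fderiv ℝ (fderiv ℝ G)) := h1.fderiv_right (by norm_num)
  refine ContDiff.sum fun i _ => ?_
  simp only [iteratedFDeriv_two_apply]
  exact (h2.clm_apply contDiff_const).clm_apply contDiff_const

theorem rs_rep {n : ℕ} (hn : 3 ≤ n) (p : EuclideanSpace ℝ (Fin n)) (s C μ : ℝ) (hs : 0 < s)
    (hC : 0 < C) (hμ : μ + 2 < n)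
    {f : EuclideanSpace ℝ (Fin n) → ℝ} (hf : ContDiffOn ℝ 2 f (ball p s \ {p}))
    (h0 : ∀ x ∈ ball p s \ {p}, rsLap f x = 0) (hf0 : ∀ x ∉ ball p s \ {p}, f x = 0)
    (hb : ∀ x ∈ ball p s \ {p}, |f x| ≤ C * ‖x - p‖ ^ (-μ)) :
    ∃ w : EuclideanSpace ℝ (Fin n) → ℝ, ContDiff ℝ 2 w ∧
      ∀ x ∈ ball p (s / 2) \ {p}, w x = f x := by
  have hW : IsOpen (ball p s \ {p}) := isOpen_ball.sdiff isClosed_singleton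
  have hfm : Measurable f := rs_measurable hW hf.continuousOn hf0
  have hfi : Integrable f := by
    refine (rs_intbound (by omega) p s μ C (by linarith)).mono' hfm.aestronglyMeasurable ?_
    refine Eventually.of_forall fun x => ?_
    by_cases hx : x ∈ ball p s \ {p}
    · rw [Set.indicator_of_mem hx.1]; exact hb x hx
    · rw [hf0 x hx, norm_zero]
      apply Set.indicator_nonneg
      intro y _; positivity
  obtain ⟨G, a, hG, hGa, hG0, hc⟩ := rs_kernel hn
  have hG2 : ContDiff ℝ 2 G := hG.of_le (by norm_num)
  set ρ := rsLap G with hρ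
  set c := ∫ z, ρ z with hcdef
  have hρd : ContDiff ℝ 2 ρ := rsLap_contDiff hG
  have hρs : HasCompactSupport ρ := by
    refine HasCompactSupport.of_support_subset_isCompact (isCompact_closedBall 0 2) ?_
    intro z hz
    by_contra hz'
    apply hz
    apply hG0
    simp at hz'
    exact hz'.le
  obtain ⟨B, hB⟩ := hρs.exists_bound_of_continuous hρd.continuous
  set ε₀ := s / 8 with hε₀
  have hε₀pos : 0 < ε₀ := by positivity
  let κ : ℝ → ℝ := fun ε => ε ^ (2 - n : ℝ) * ε⁻¹ ^ 2
  let I : ℝ → EuclideanSpace ℝ (Fin n) → ℝ := fun ε x => ∫ y, f y * (κ ε * ρ (ε⁻¹ • (y - x)))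
  have hint : ∀ ε x, Integrable (fun y => f y * (κ ε * ρ (ε⁻¹ • (y - x)))) := by
    intro ε x
    have hcont : Continuous (fun y => κ ε * ρ (ε⁻¹ • (y - x))) := by
      have := hρd.continuous
      fun_prop
    refine hfi.mul_bdd (c := |κ ε| * B) hcont.aestronglyMeasurable ?_
    refine Eventually.of_forall fun y => ?_
    rw [norm_mul, Real.norm_eq_abs]
    gcongr
    exact hB _
  -- independence of the scale
  have hindep : ∀ x ∈ ball p (s / 2), ∀ ε, 0 < ε → ε ≤ ε₀ → I ε x = I ε₀ x := by
    intro x hx ε hε hεε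
    let Gs : ℝ → EuclideanSpace ℝ (Fin n) → ℝ := fun ε y => ε ^ (2 - n : ℝ) * G (ε⁻¹ • (y - x))
    have hGs : ∀ ε, ContDiff ℝ 2 (Gs ε) := fun ε => by fun_prop
    have hGsl : ∀ ε y, rsLap (Gs ε) y = κ ε * ρ (ε⁻¹ • (y - x)) := fun ε y =>
      rsLap_scale hG2 _ _ _ _
    have hGsv : ∀ ε y, 0 < ε → ε ≤ ε₀ → 2 * ε₀ ≤ ‖y - x‖ → Gs ε y = a * ‖y - x‖ ^ (2 - n : ℝ) := by
      intro ε y hε hεε hy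
      have hn1 : ‖ε⁻¹ • (y - x)‖ = ε⁻¹ * ‖y - x‖ := by
        rw [norm_smul, Real.norm_of_nonneg (by positivity)]
      have : 2 ≤ ‖ε⁻¹ • (y - x)‖ := by
        rw [hn1, inv_mul_eq_div, le_div_iff₀ hε]; linarith
      simp only [Gs]
      rw [hGa _ this, hn1, Real.mul_rpow (by positivity) (norm_nonneg _), Real.inv_rpow hε.le]
      have : ε ^ (2 - n : ℝ) ≠ 0 := (Real.rpow_pos_of_pos hε _).ne'
      field_simp
    have hsup : Function.support (fun y => Gs ε y - Gs ε₀ y) ⊆ closedBall x (2 * ε₀) := by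
      intro y hy
      by_contra hy'
      rw [mem_closedBall, dist_eq_norm, not_le] at hy'
      apply hy
      simp only
      rw [hGsv ε y hε hεε hy'.le, hGsv ε₀ y hε₀pos le_rfl hy'.le, sub_self]
    have hts : tsupport (fun y => Gs ε y - Gs ε₀ y) ⊆ closedBall x (2 * ε₀) :=
      closure_minimal hsup isClosed_closedBall
    have hw := rs_weak (by omega) p s C μ hs hC hμ hf h0 hf0 hb (φ := fun y => Gs ε y - Gs ε₀ y)
      ((hGs ε).sub (hGs ε₀)) ((isCompact_closedBall x (2 * ε₀)).of_isClosed_subset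
        (isClosed_tsupport _) hts)
      (hts.trans (closedBall_subset_ball' (by rw [mem_ball] at hx; linarith)))
    simp only [rsLap_sub (hGs ε) (hGs ε₀), hGsl, mul_sub] at hw
    rw [integral_sub (hint ε x) (hint ε₀ x)] at hw
    exact sub_eq_zero.1 hw
  have hchange : ∀ x ε, 0 < ε → I ε x = ∫ z, f (x + ε • z) * ρ z := by
    intro x ε hε
    have e1 := Measure.integral_comp_smul (volume : Measure (EuclideanSpace ℝ (Fin n)))
      (fun y => f (x + y) * ρ (ε⁻¹ • y)) ε
    simp only [inv_smul_smul₀ hε.ne'] at e1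
    rw [e1]
    have e2 := integral_add_left_eq_self (μ := (volume : Measure (EuclideanSpace ℝ (Fin n))))
      (fun y => f y * ρ (ε⁻¹ • (y - x))) x
    simp only [add_sub_cancel_left] at e2
    rw [e2, finrank_euclideanSpace_fin, abs_of_nonneg (by positivity), smul_eq_mul, ← integral_const_mul]
    refine integral_congr_ae (Eventually.of_forall fun y => ?_)
    beta_reduce
    have : κ ε = (ε ^ n)⁻¹ := by
      simp only [κ]
      rw [Real.rpow_sub hε, Real.rpow_natCast]
      norm_cast
      field_simp
    rw [this]; ring
  have hlim : ∀ x ∈ ball p s \ {p}, Tendsto (fun ε => I ε x) (𝓝[>] 0) (𝓝 (f x * c)) := by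
    intro x hx
    have hcx : ContinuousAt f x := hf.continuousOn.continuousAt (hW.mem_nhds hx)
    have hev : ∀ᶠ y in 𝓝 x, |f y| < |f x| + 1 :=
      (hcx.abs).eventually_lt continuousAt_const (by simp)
    obtain ⟨δ, hδ, hball⟩ := Metric.eventually_nhds_iff.1 hev
    have key : Tendsto (fun ε : ℝ => ∫ z, f (x + ε • z) * ρ z) (𝓝[>] 0) (𝓝 (∫ z, f x * ρ z)) := by
      refine tendsto_integral_filter_of_dominated_convergence (fun z => (|f x| + 1) * |ρ z|) ?_ ?_ ?_ ?_
      · refine Eventually.of_forall fun ε => ?_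
        have h1 : Measurable (fun z => f (x + ε • z)) := hfm.comp (by fun_prop)
        exact (h1.mul hρd.continuous.measurable).aestronglyMeasurable
      · have : ∀ᶠ ε in 𝓝[>] (0:ℝ), ε < δ / 3 := 
          mem_nhdsWithin_of_mem_nhds (Iio_mem_nhds (by positivity))
        filter_upwards [this, self_mem_nhdsWithin] with ε hε hε0
        have hε0 : 0 < ε := hε0
        refine Eventually.of_forall fun z => ?_
        rw [norm_mul, Real.norm_eq_abs, Real.norm_eq_abs]
        by_cases hz : 2 ≤ ‖z‖
        · rw [hG0 z hz]; simp
        · push Not at hz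
          gcongr
          refine (hball ?_).le
          rw [dist_eq_norm, add_sub_cancel_left, norm_smul, Real.norm_of_nonneg hε0.le]
          nlinarith
      · exact ((hρd.continuous.integrable_of_hasCompactSupport hρs).abs).const_mul _
      · refine Eventually.of_forall fun z => ?_
        refine Tendsto.mul_const _ ?_
        have h1 : Tendsto (fun ε : ℝ => x + ε • z) (𝓝[>] 0) (𝓝 x) := by
          have : Continuous (fun ε : ℝ => x + ε • z) := by fun_prop
          have := this.tendsto 0
          simp only [zero_smul, add_zero] at this
          exact this.mono_left nhdsWithin_le_nhds
        exact hcx.tendsto.comp h1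
    rw [integral_const_mul] at key
    refine key.congr' ?_
    filter_upwards [self_mem_nhdsWithin] with ε hε
    exact (hchange x ε hε).symm
  refine ⟨fun x => c⁻¹ * I ε₀ x, ?_, ?_⟩
  · refine contDiff_const.mul ?_
    have hg : ContDiff ℝ 2 (fun z => κ ε₀ * ρ (ε₀⁻¹ • (-z))) := by fun_prop
    have hgs : HasCompactSupport (fun z => κ ε₀ * ρ (ε₀⁻¹ • (-z))) := by
      have h1 : HasCompactSupport (fun z => ρ (-ε₀⁻¹ • z)) := hρs.comp_smul (by
        simp [hε₀pos.ne'])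
      simp only [smul_neg, ← neg_smul]
      exact h1.mul_left
    have := hgs.contDiff_convolution_right (n := 2) (ContinuousLinearMap.mul ℝ ℝ)
      hfi.locallyIntegrable hg (μ := volume)
    have heq : I ε₀ = convolution f (fun z => κ ε₀ * ρ (ε₀⁻¹ • (-z)))
        (ContinuousLinearMap.mul ℝ ℝ) volume := by
      ext x
      simp [I, convolution]
    rw [heq]
    exact this
  · intro x hx
    have hx1 : x ∈ ball p s \ {p} := ⟨ball_subset_ball (by linarith) hx.1, hx.2⟩
    have : Tendsto (fun ε => I ε x) (𝓝[>] 0) (𝓝 (I ε₀ x)) := by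
      refine tendsto_const_nhds.congr' ?_
      have : ∀ᶠ ε in 𝓝[>] (0:ℝ), ε < ε₀ := 
          mem_nhdsWithin_of_mem_nhds (Iio_mem_nhds (by positivity))
      filter_upwards [this, self_mem_nhdsWithin] with ε hε hε0
      exact (hindep x hx.1 ε hε0 hε.le).symm
    have e := tendsto_nhds_unique this (hlim x hx1)
    simp only [e]
    field_simp

/-- **removable singularity.** Let n ≥ 3, and let u be harmonic on the
punctured ball B_r(p) ∖ {p} ⊂ ℝⁿ with |u(x)| ≤ C·|x − p|^{−μ} near p, where
0 < μ < n − 2. Then u extends to a harmonic function on all of B_r(p). -/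
theorem stmt_7 (n : ℕ) (hn : 3 ≤ n) (p : EuclideanSpace ℝ (Fin n)) (r : ℝ) (hr : 0 < r)
    (u : EuclideanSpace ℝ (Fin n) → ℝ)
    (hu : IsHarmonicOnEuc u (Metric.ball p r \ {p}))
    (s₀ : ℝ) (hs₀ : s₀ ∈ Set.Ioo 0 r)
    (C : ℝ) (hC : 0 < C) (μ : ℝ) (hμ : μ ∈ Set.Ioo (0 : ℝ) ((n : ℝ) - 2))
    (hbound : ∀ x ∈ Metric.ball p s₀ \ {p}, |u x| ≤ C * ‖x - p‖ ^ (-μ)) :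
    ∃ v : EuclideanSpace ℝ (Fin n) → ℝ,
      IsHarmonicOnEuc v (Metric.ball p r) ∧
      ∀ x ∈ Metric.ball p r \ {p}, v x = u x := by
  have hnR : (3:ℝ) ≤ n := by exact_mod_cast hn
  obtain ⟨hud, hul⟩ := hu
  have hU : IsOpen (ball p r \ {p}) := isOpen_ball.sdiff isClosed_singleton
  have hW : IsOpen (ball p s₀ \ {p}) := isOpen_ball.sdiff isClosed_singleton
  have hWU : ball p s₀ \ {p} ⊆ ball p r \ {p} :=
    Set.diff_subset_diff_left (ball_subset_ball hs₀.2.le)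
  have hul' : ∀ x ∈ ball p r \ {p}, rsLap u x = 0 := by
    intro x hx
    rw [← hul x hx]
    simp only [rsLap]
    rw [iteratedFDerivWithin_of_isOpen 2 hU hx]
  set f : EuclideanSpace ℝ (Fin n) → ℝ := (ball p s₀ \ {p}).indicator u with hf
  have hfu : ∀ x ∈ ball p s₀ \ {p}, f x = u x := fun x hx => Set.indicator_of_mem hx u
  have hfd : ContDiffOn ℝ 2 f (ball p s₀ \ {p}) := (hud.mono hWU).congr hfu
  have hfl : ∀ x ∈ ball p s₀ \ {p}, rsLap f x = 0 := by
    intro x hx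
    rw [rsLap_congr (g := u) (by filter_upwards [hW.mem_nhds hx] with y hy using hfu y hy)]
    exact hul' x (hWU hx)
  obtain ⟨w, hw, hwf⟩ := rs_rep hn p s₀ C μ hs₀.1 hC (by linarith [hμ.2]) hfd hfl
    (fun x hx => Set.indicator_of_notMem hx u) (fun x hx => by rw [hfu x hx]; exact hbound x hx)
  have hs2 : 0 < s₀ / 2 := by linarith [hs₀.1]
  have hwu : ∀ x ∈ ball p (s₀ / 2) \ {p}, w x = u x := fun x hx =>
    (hwf x hx).trans (hfu x ⟨ball_subset_ball (by linarith) hx.1, hx.2⟩)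
  have hV : IsOpen (ball p (s₀ / 2) \ {p}) := isOpen_ball.sdiff isClosed_singleton
  classical
  set v : EuclideanSpace ℝ (Fin n) → ℝ := fun x => if x = p then w x else u x with hv
  have hvu : ∀ x ≠ p, v x = u x := fun x hx => by simp [hv, hx]
  have hvw : v =ᶠ[𝓝 p] w := by
    filter_upwards [ball_mem_nhds p hs2] with y hy
    by_cases hyp : y = p
    · simp [hv, hyp]
    · rw [hvu y hyp, hwu y ⟨hy, hyp⟩]
  have hvu' : ∀ x ≠ p, v =ᶠ[𝓝 x] u := fun x hx => by
    filter_upwards [isOpen_ne.mem_nhds hx] with y hy using hvu y hy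
  have hwp : rsLap w p = 0 := by
    have : NeZero n := ⟨by omega⟩
    have : Nontrivial (EuclideanSpace ℝ (Fin n)) := inferInstance
    have : (𝓝[≠] p).NeBot := Module.punctured_nhds_neBot ℝ _ p
    have h1 : Tendsto (rsLap w) (𝓝[≠] p) (𝓝 (rsLap w p)) :=
      (rsLap_cont hw).continuousAt.tendsto.mono_left nhdsWithin_le_nhds
    have h2 : Tendsto (rsLap w) (𝓝[≠] p) (𝓝 0) := by
      refine tendsto_const_nhds.congr' ?_
      filter_upwards [mem_nhdsWithin_of_mem_nhds (ball_mem_nhds p hs2), self_mem_nhdsWithin]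
        with y hy hyp
      rw [rsLap_congr (g := u) (by filter_upwards [hV.mem_nhds ⟨hy, hyp⟩] with z hz using hwu z hz)]
      exact (hul' y ⟨ball_subset_ball (by linarith [hs₀.2]) hy, hyp⟩).symm
    exact tendsto_nhds_unique h1 h2
  refine ⟨v, ⟨?_, ?_⟩, fun x hx => hvu x hx.2⟩
  · intro x hx
    apply ContDiffAt.contDiffWithinAt
    by_cases hxp : x = p
    · subst hxp
      exact hw.contDiffAt.congr_of_eventuallyEq hvw
    · exact (hud.contDiffAt (hU.mem_nhds ⟨hx, hxp⟩)).congr_of_eventuallyEq (hvu' x hxp)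
  · intro x hx
    rw [iteratedFDerivWithin_of_isOpen 2 isOpen_ball hx]
    change rsLap v x = 0
    by_cases hxp : x = p
    · subst hxp
      rw [rsLap_congr hvw, hwp]
    · rw [rsLap_congr (hvu' x hxp)]
      exact hul' x ⟨hx, hxp⟩
end

section
/- Let P = {p₁, …, p_m} be a finite set of points in ℝ³ whose ℤ-translates P + ℤe₃ = {p + k·e₃ : p ∈ P, k ∈ ℤ} are pairwise distinct, where e₃ = (0,0,1). Let u be a real-valued harmonic function on ℝ³ ∖ (P + ℤe₃) which is 1-periodic in the third coordinate, i.e. u(x + e₃) = u(x) for all x in its domain. Suppose there exist s₀ > 0, C > 0 and μ ∈ (0,1) such that |u(x)| ≤ C·|x − q|^{−μ} whenever q ∈ P + ℤe₃ and 0 < |x − q| < s₀, and suppose u(x) → 0 as x₁² + x₂² → ∞. Then u is identically zero on ℝ³ ∖ (P + ℤe₃). -/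
open Set Filter Topology InnerProductSpace Laplacian

theorem aux_d2 {f : EuclideanSpace ℝ (Fin 3) → ℝ} {x v : EuclideanSpace ℝ (Fin 3)}
    (hf : ContDiffAt ℝ 2 f x) :
    deriv (deriv (fun t : ℝ => f (x + t • v))) 0 = iteratedFDeriv ℝ 2 f x ![v, v] := by
  rw [iteratedFDeriv_two_apply]
  have hline : ∀ t : ℝ, HasDerivAt (fun t : ℝ => x + t • v) v t := by
    intro t
    simpa using ((hasDerivAt_id t).smul_const v).const_add x
  have hc : Tendsto (fun t : ℝ => x + t • v) (𝓝 0) (𝓝 x) := by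
    have := (hline 0).continuousAt.tendsto
    simpa using this
  have h1 : ∀ᶠ y in 𝓝 x, DifferentiableAt ℝ f y := by
    filter_upwards [hf.eventually (by simp)] with y hy
    exact hy.differentiableAt (by norm_num)
  have h2 : deriv (fun t : ℝ => f (x + t • v)) =ᶠ[𝓝 0] fun t => fderiv ℝ f (x + t • v) v := by
    filter_upwards [hc.eventually h1] with t ht
    exact (ht.hasFDerivAt.comp_hasDerivAt t (hline t)).deriv
  rw [h2.deriv_eq]
  have h3 : DifferentiableAt ℝ (fderiv ℝ f) x :=
    (hf.fderiv_right (m := 1) (by norm_num)).differentiableAt (by norm_num)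
  have h4 : HasDerivAt (fun t : ℝ => fderiv ℝ f (x + t • v)) (fderiv ℝ (fderiv ℝ f) x v) 0 := by
    refine HasFDerivAt.comp_hasDerivAt (f := fun t : ℝ => x + t • v) 0 ?_ (hline 0)
    simpa using h3.hasFDerivAt
  have h5 := (h4.clm_apply (hasDerivAt_const (0:ℝ) v)).deriv
  simpa using h5

theorem aux_lap {f : EuclideanSpace ℝ (Fin 3) → ℝ} (x : EuclideanSpace ℝ (Fin 3)) :
    Δ f x = ∑ i : Fin 3, iteratedFDeriv ℝ 2 f x
      ![EuclideanSpace.single i 1, EuclideanSpace.single i 1] := by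
  rw [laplacian_eq_iteratedFDeriv_orthonormalBasis f (EuclideanSpace.basisFun (Fin 3) ℝ)]
  simp

theorem aux_lap' {f : EuclideanSpace ℝ (Fin 3) → ℝ} {x : EuclideanSpace ℝ (Fin 3)}
    (hf : ContDiffAt ℝ 2 f x) :
    Δ f x = ∑ i : Fin 3, deriv (deriv (fun t : ℝ => f (x + t • EuclideanSpace.single i 1))) 0 := by
  rw [aux_lap]
  exact Finset.sum_congr rfl fun i _ => (aux_d2 hf).symm

theorem aux_1d {g : ℝ → ℝ} (hc : ContinuousAt g 0) (h : IsLocalMax g 0) :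
    deriv (deriv g) 0 ≤ 0 := by
  by_contra! hpos
  have hm := isLocalMin_of_deriv_deriv_pos hpos h.deriv_eq_zero hc
  have he : g =ᶠ[𝓝 0] fun _ => g 0 := by
    filter_upwards [h, hm] with t h1 h2
    exact le_antisymm h1 h2
  have := he.deriv.deriv_eq
  simp at this
  linarith

theorem aux_max {f : EuclideanSpace ℝ (Fin 3) → ℝ} {x : EuclideanSpace ℝ (Fin 3)}
    (hf : ContDiffAt ℝ 2 f x) (h : IsLocalMax f x) : Δ f x ≤ 0 := by
  rw [aux_lap' hf]
  refine Finset.sum_nonpos fun i _ => ?_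
  have hc : ContinuousAt (fun t : ℝ => x + t • (EuclideanSpace.single i 1 : EuclideanSpace ℝ (Fin 3))) 0 := by
    fun_prop
  refine aux_1d ?_ ?_
  · refine ContinuousAt.comp (f := fun t : ℝ => x + t • (EuclideanSpace.single i 1 : EuclideanSpace ℝ (Fin 3))) ?_ hc
    simpa using hf.continuousAt
  · have hc' := hc.tendsto
    simp only [zero_smul, add_zero] at hc'
    have := hc'.eventually h
    simpa [IsLocalMax, IsMaxFilter] using this

theorem aux_dist_sq (x q : EuclideanSpace ℝ (Fin 3)) :
    dist x q = Real.sqrt ((x 0 - q 0)^2 + (x 1 - q 1)^2 + (x 2 - q 2)^2) := by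
  simp [EuclideanSpace.dist_eq, Fin.sum_univ_three, Real.dist_eq, sq_abs]

theorem aux_line (A b a : ℝ) (ha : 0 < a) (hA : A = a ^ 2) :
    deriv (deriv (fun t : ℝ => (Real.sqrt (A + 2 * b * t + t ^ 2))⁻¹)) 0
      = - (a ^ 3)⁻¹ + 3 * b ^ 2 * (a ^ 5)⁻¹ := by
  have hS : ∀ t : ℝ, HasDerivAt (fun t : ℝ => A + 2 * b * t + t ^ 2) (2 * b + 2 * t) t := by
    intro t
    have h1 := (((hasDerivAt_id t).const_mul (2 * b)).const_add A).add ((hasDerivAt_id t).pow 2)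
    refine HasDerivAt.congr_deriv h1 ?_
    simp
  have hpos : ∀ᶠ t in 𝓝 (0:ℝ), 0 < A + 2 * b * t + t ^ 2 := by
    apply (hS 0).continuousAt.tendsto.eventually_const_lt
    simp [hA]; positivity
  have h1 : deriv (fun t : ℝ => (Real.sqrt (A + 2 * b * t + t ^ 2))⁻¹) =ᶠ[𝓝 0]
      fun t => - (b + t) * ((Real.sqrt (A + 2 * b * t + t ^ 2)) ^ 3)⁻¹ := by
    filter_upwards [hpos] with t ht
    have hs : 0 < Real.sqrt (A + 2 * b * t + t ^ 2) := Real.sqrt_pos.2 ht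
    have := (((hS t).sqrt ht.ne').inv hs.ne').deriv
    rw [Pi.inv_def] at this
    rw [this]
    field_simp
  rw [h1.deriv_eq]
  have h0 : Real.sqrt (A + 2 * b * 0 + 0 ^ 2) = a := by
    rw [hA]; simp [ha.le]
  have hs : 0 < Real.sqrt (A + 2 * b * 0 + 0 ^ 2) := by rw [h0]; exact ha
  have h2 := (((hasDerivAt_id (0:ℝ)).const_add b).neg).mul
    ((((hS 0).sqrt (Real.sqrt_pos.1 hs).ne').pow 3).inv (by simp only [Pi.pow_apply]; positivity))
  have h3 := h2.deriv
  simp only [Pi.pow_def, Pi.inv_def, Pi.mul_def, Pi.neg_def, id, h0] at h3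
  rw [h3]
  field_simp
  norm_num
  ring

theorem aux_inv_contDiff {x q : EuclideanSpace ℝ (Fin 3)} (h : x ≠ q) :
    ContDiffAt ℝ 2 (fun y => (dist y q)⁻¹) x := by
  apply ContDiffAt.inv
  · exact ContDiffAt.dist ℝ contDiffAt_id contDiffAt_const h
  · exact dist_ne_zero.2 h

theorem aux_inv_lap {x q : EuclideanSpace ℝ (Fin 3)} (h : x ≠ q) :
    Δ (fun y => (dist y q)⁻¹) x = 0 := by
  rw [aux_lap' (aux_inv_contDiff h)]
  have ha : 0 < dist x q := dist_pos.2 h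
  have key : ∀ i : Fin 3, deriv (deriv (fun t : ℝ =>
      (dist (x + t • (EuclideanSpace.single i 1 : EuclideanSpace ℝ (Fin 3))) q)⁻¹)) 0
      = - ((dist x q) ^ 3)⁻¹ + 3 * (x i - q i) ^ 2 * ((dist x q) ^ 5)⁻¹ := by
    intro i
    rw [← aux_line ((dist x q)^2) (x i - q i) (dist x q) ha rfl]
    have : (fun t : ℝ => (dist (x + t • (EuclideanSpace.single i 1 : EuclideanSpace ℝ (Fin 3))) q)⁻¹)
      = (fun t : ℝ => (Real.sqrt ((dist x q)^2 + 2 * (x i - q i) * t + t ^ 2))⁻¹) := by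
      funext t
      congr 1
      rw [aux_dist_sq, aux_dist_sq x, Real.sq_sqrt (by positivity)]
      congr 1
      fin_cases i <;> simp <;> ring
    rw [this]
  simp only [key, Fin.sum_univ_three]
  have h2 : (x 0 - q 0)^2 + (x 1 - q 1)^2 + (x 2 - q 2)^2 = (dist x q)^2 := by
    rw [aux_dist_sq, Real.sq_sqrt (by positivity)]
  have : (x 0 - q 0)^2 = (dist x q)^2 - (x 1 - q 1)^2 - (x 2 - q 2)^2 := by linarith
  rw [this]
  field_simp
  ring

theorem aux_rho_contDiff (x : EuclideanSpace ℝ (Fin 3)) :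
    ContDiffAt ℝ 2 (fun y : EuclideanSpace ℝ (Fin 3) => y 0 ^ 2 + y 1 ^ 2) x := by
  fun_prop

theorem aux_quad (a b c : ℝ) : deriv (deriv (fun t : ℝ => a + b * t + c * t ^ 2)) 0 = 2 * c := by
  have : deriv (fun t : ℝ => a + b * t + c * t ^ 2) = fun t => b + 2 * c * t := by
    funext t
    have h1 := (((hasDerivAt_id t).const_mul b).const_add a).add
      (((hasDerivAt_id t).pow 2).const_mul c)
    refine (HasDerivAt.congr_deriv h1 ?_).deriv
    simp; ring
  rw [this]
  simp

theorem aux_rho_lap (x : EuclideanSpace ℝ (Fin 3)) :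
    Δ (fun y : EuclideanSpace ℝ (Fin 3) => y 0 ^ 2 + y 1 ^ 2) x = 4 := by
  rw [aux_lap' (aux_rho_contDiff x), Fin.sum_univ_three]
  have e0 := aux_quad (x 0 ^ 2 + x 1 ^ 2) (2 * x 0) 1
  have e1 := aux_quad (x 0 ^ 2 + x 1 ^ 2) (2 * x 1) 1
  have e2 := aux_quad (x 0 ^ 2 + x 1 ^ 2) 0 0
  have f0 : (fun t : ℝ => (x + t • (EuclideanSpace.single 0 1 : EuclideanSpace ℝ (Fin 3))) 0 ^ 2 + (x + t • (EuclideanSpace.single 0 1 : EuclideanSpace ℝ (Fin 3))) 1 ^ 2) = fun t => (x 0 ^ 2 + x 1 ^ 2) + (2 * x 0) * t + 1 * t ^ 2 := by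
    funext t; simp; ring
  have f1 : (fun t : ℝ => (x + t • (EuclideanSpace.single 1 1 : EuclideanSpace ℝ (Fin 3))) 0 ^ 2 + (x + t • (EuclideanSpace.single 1 1 : EuclideanSpace ℝ (Fin 3))) 1 ^ 2) = fun t => (x 0 ^ 2 + x 1 ^ 2) + (2 * x 1) * t + 1 * t ^ 2 := by
    funext t; simp; ring
  have f2 : (fun t : ℝ => (x + t • (EuclideanSpace.single 2 1 : EuclideanSpace ℝ (Fin 3))) 0 ^ 2 + (x + t • (EuclideanSpace.single 2 1 : EuclideanSpace ℝ (Fin 3))) 1 ^ 2) = fun t => (x 0 ^ 2 + x 1 ^ 2) + 0 * t + 0 * t ^ 2 := by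
    funext t; simp
  rw [f0, f1, f2, e0, e1, e2]; norm_num

theorem aux_small (C μ B δ : ℝ) (hμ : μ < 1) (hδ : 0 < δ) :
    ∃ r₀ > 0, ∀ r, 0 < r → r < r₀ → C * r ^ (-μ) + B < δ * r⁻¹ := by
  have hc : ContinuousAt (fun r : ℝ => C * r ^ (1 - μ) + B * r) 0 := by
    have : ContinuousAt (fun r : ℝ => r ^ (1 - μ)) 0 :=
      Real.continuousAt_rpow_const _ _ (Or.inr (by linarith))
    fun_prop
  have h0 : (fun r : ℝ => C * r ^ (1 - μ) + B * r) 0 < δ := by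
    simp [Real.zero_rpow (by linarith : 1 - μ ≠ 0), hδ]
  obtain ⟨r₀, hr₀, h⟩ := Metric.eventually_nhds_iff.1 (hc.tendsto.eventually_lt_const h0)
  refine ⟨r₀, hr₀, fun r hr hrr => ?_⟩
  have := h (y := r) (by simpa [abs_of_pos hr] using hrr)
  rw [← div_eq_mul_inv, lt_div_iff₀ hr]
  have e : r ^ (1 - μ) = r ^ (-μ) * r := by
    rw [show 1 - μ = -μ + 1 by ring, Real.rpow_add_one hr.ne']
  rw [e] at this
  linarith

theorem aux_stepA {w : EuclideanSpace ℝ (Fin 3) → ℝ} {q : EuclideanSpace ℝ (Fin 3)}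
    {s C μ B : ℝ} (hμ : μ < 1)
    (hw : ∀ y, y ≠ q → dist y q ≤ s → ContDiffAt ℝ 2 w y)
    (hlap : ∀ y, y ≠ q → dist y q ≤ s → 0 < Δ w y)
    (hb : ∀ y, y ≠ q → dist y q ≤ s → w y ≤ C * (dist y q) ^ (-μ) + B)
    {x : EuclideanSpace ℝ (Fin 3)} (hx : x ≠ q) (hxs : dist x q < s) :
    ∃ z, dist z q = s ∧ w x ≤ w z := by
  have hs : 0 < s := dist_nonneg.trans_lt hxs
  have hxp : 0 < dist x q := dist_pos.2 hx
  by_contra! hcon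
  have hne : (Metric.sphere q s).Nonempty := (NormedSpace.sphere_nonempty).2 hs.le
  obtain ⟨z, hz, hzmax⟩ := (isCompact_sphere q s).exists_isMaxOn hne (f := w) (fun y hy =>
    (hw y (dist_pos.1 (by rw [hy]; exact hs)) (le_of_eq hy)).continuousAt.continuousWithinAt)
  have hlt := hcon z hz
  obtain ⟨δ, hδ, hδx⟩ : ∃ δ > 0, w z < w x - δ * (dist x q)⁻¹ := by
    refine ⟨(w x - w z) / 2 * dist x q, by have : 0 < w x - w z := by linarith
                                           positivity, ?_⟩
    rw [mul_assoc, mul_inv_cancel₀ hxp.ne']; linarith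
  set f : EuclideanSpace ℝ (Fin 3) → ℝ := w - δ • (fun y => (dist y q)⁻¹) with hf
  have hfe : ∀ y, f y = w y - δ * (dist y q)⁻¹ := fun y => by simp [hf]
  have hfc : ∀ y, y ≠ q → dist y q ≤ s → ContDiffAt ℝ 2 f y := fun y h1 h2 =>
    (hw y h1 h2).sub ((aux_inv_contDiff h1).const_smul δ)
  have hfl : ∀ y, y ≠ q → dist y q ≤ s → 0 < Δ f y := fun y h1 h2 => by
    have hd : ContDiffAt ℝ 2 (δ • fun y => (dist y q)⁻¹) y := (aux_inv_contDiff h1).const_smul δ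
    rw [hf, (hw y h1 h2).laplacian_sub hd, laplacian_smul δ (aux_inv_contDiff h1), aux_inv_lap h1]
    simpa using hlap y h1 h2
  obtain ⟨r₀, hr₀, hr⟩ := aux_small C μ (B - f x) δ hμ hδ
  set r₁ := min (r₀ / 2) (dist x q) with hr₁
  have hr₁x : r₁ ≤ dist x q := min_le_right _ _
  have hr₁p : 0 < r₁ := lt_min (by linarith) hxp
  have hK : IsCompact (Metric.closedBall q s ∩ {y | r₁ ≤ dist y q}) :=
    (isCompact_closedBall q s).inter_right (isClosed_le continuous_const (by fun_prop))
  obtain ⟨y₀, ⟨hy1, hy2⟩, hymax⟩ := hK.exists_isMaxOn (f := f) ⟨x, hxs.le, hr₁x⟩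
    (fun y hy => (hfc y (dist_pos.1 (hr₁p.trans_le hy.2)) hy.1).continuousAt.continuousWithinAt)
  have hy0 : y₀ ≠ q := dist_pos.1 (hr₁p.trans_le hy2)
  have hxy : f x ≤ f y₀ := hymax (a := x) ⟨hxs.le, hr₁x⟩
  have hys : dist y₀ q < s := by
    refine lt_of_le_of_ne hy1 fun he => ?_
    have h1 : w y₀ ≤ w z := hzmax (a := y₀) he
    rw [hfe, hfe] at hxy
    have : 0 < δ * (dist y₀ q)⁻¹ := by rw [he]; positivity
    linarith
  have hloc : IsLocalMax f y₀ := by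
    have h1 : ∀ᶠ y in 𝓝 y₀, dist y q < s :=
      (continuous_id.dist continuous_const).continuousAt.eventually_lt continuousAt_const hys
    filter_upwards [h1, isOpen_ne.mem_nhds hy0] with y hy hyq
    by_cases h2 : r₁ ≤ dist y q
    · exact hymax (a := y) ⟨hy.le, h2⟩
    · have h3 := hr (dist y q) (dist_pos.2 hyq) (by
        have := min_le_left (r₀ / 2) (dist x q)
        push Not at h2; linarith)
      have h4 := hb y hyq hy.le
      rw [hfe y]; linarith
  exact absurd (aux_max (hfc y₀ hy0 hy1) hloc) (not_le.2 (hfl y₀ hy0 hy1))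

theorem aux_rho_ball {M s : ℝ} {q z : EuclideanSpace ℝ (Fin 3)}
    (hM : q 0 ^ 2 + q 1 ^ 2 ≤ M) (hz : dist z q ≤ s) :
    z 0 ^ 2 + z 1 ^ 2 ≤ 2 * M + 2 * s ^ 2 := by
  have h2 : (z 0 - q 0)^2 + (z 1 - q 1)^2 + (z 2 - q 2)^2 = (dist z q)^2 := by
    rw [aux_dist_sq, Real.sq_sqrt (by positivity)]
  have h3 : (dist z q) ^ 2 ≤ s ^ 2 := by gcongr
  nlinarith [sq_nonneg (z 0 - 2 * q 0), sq_nonneg (z 1 - 2 * q 1), sq_nonneg (z 2 - q 2)]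

theorem aux_main (L : Set (EuclideanSpace ℝ (Fin 3))) (e₃ : EuclideanSpace ℝ (Fin 3))
    (he₃ : e₃ = EuclideanSpace.single (2 : Fin 3) (1 : ℝ))
    (hLt : ∀ x, ∀ k : ℤ, x + k • e₃ ∈ L ↔ x ∈ L) (s : ℝ) (hs : 0 < s)
    (hsep : ∀ p ∈ L, ∀ q ∈ L, p ≠ q → 2 * s ≤ dist p q)
    (M : ℝ) (hM : ∀ q ∈ L, q 0 ^ 2 + q 1 ^ 2 ≤ M)
    (u : EuclideanSpace ℝ (Fin 3) → ℝ)
    (hu : ∀ x, x ∉ L → ContDiffAt ℝ 2 u x ∧ Δ u x = 0)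
    (hper : ∀ x, x ∉ L → u (x + e₃) = u x)
    (C μ : ℝ) (hμ : μ < 1)
    (hbound : ∀ q ∈ L, ∀ x, x ∉ L → dist x q ≤ s → u x ≤ C * (dist x q) ^ (-μ))
    (hdecay : ∀ ε : ℝ, 0 < ε → ∃ R : ℝ, ∀ x, x ∉ L → R ≤ (x 0) ^ 2 + (x 1) ^ 2 → u x ≤ ε)
    (x : EuclideanSpace ℝ (Fin 3)) (hx : x ∉ L) : u x ≤ 0 := by
  have hLc : IsClosed L := Metric.isClosed_of_pairwise_le_dist (ε := 2 * s) (by linarith)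
    (fun p hp q hq h => hsep p hp q hq h)
  have hper' : ∀ y, y ∉ L → ∀ k : ℤ, u (y + k • e₃) = u y := by
    intro y hy k
    induction k using Int.induction_on with
    | zero => simp
    | succ n ih =>
      rw [← ih, add_smul, one_smul, ← add_assoc]
      exact hper _ (by rwa [hLt])
    | pred n ih =>
      rw [← ih]
      have := hper (y + (-(n:ℤ) - 1) • e₃) (by rwa [hLt])
      rw [← this, sub_smul, one_smul]
      congr 1; abel
  refine le_of_forall_pos_le_add fun ε hε => ?_
  rw [zero_add]
  obtain ⟨R₁, hR₁⟩ := hdecay ε hε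
  obtain ⟨R, hRR₁, hRM, hRx⟩ : ∃ R, R₁ ≤ R ∧ 2 * M + 2 * s ^ 2 ≤ R ∧ x 0 ^ 2 + x 1 ^ 2 ≤ R :=
    ⟨max R₁ (max (2 * M + 2 * s ^ 2) (x 0 ^ 2 + x 1 ^ 2)), by simp, by simp, by simp⟩
  have hR0 : 0 ≤ R := by nlinarith [sq_nonneg (x 0), sq_nonneg (x 1)]
  refine le_of_forall_pos_le_add fun ε' hε' => ?_
  obtain ⟨η, hη, hηR⟩ : ∃ η > 0, η * R ≤ ε' := by
    refine ⟨ε' / (R + 1), by positivity, ?_⟩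
    rw [div_mul_eq_mul_div, div_le_iff₀ (by positivity)]
    nlinarith
  set w : EuclideanSpace ℝ (Fin 3) → ℝ := u + η • (fun y => y 0 ^ 2 + y 1 ^ 2) with hw
  have hwe : ∀ y, w y = u y + η * (y 0 ^ 2 + y 1 ^ 2) := fun y => by simp [hw]
  have hρ : ∀ y, ContDiffAt ℝ 2 (η • (fun y : EuclideanSpace ℝ (Fin 3) => y 0 ^ 2 + y 1 ^ 2)) y :=
    fun y => (aux_rho_contDiff y).const_smul η
  have hwc : ∀ y, y ∉ L → ContDiffAt ℝ 2 w y := fun y hy => (hu y hy).1.add (hρ y)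
  have hwl : ∀ y, y ∉ L → 0 < Δ w y := fun y hy => by
    rw [hw, (hu y hy).1.laplacian_add (hρ y), laplacian_smul η (aux_rho_contDiff y), aux_rho_lap,
      (hu y hy).2]
    simp [hη]
  have hc0 : ∀ (y : EuclideanSpace ℝ (Fin 3)) (k : ℤ), (y + k • e₃) 0 = y 0 := by
    intro y k; simp [he₃]
  have hc1 : ∀ (y : EuclideanSpace ℝ (Fin 3)) (k : ℤ), (y + k • e₃) 1 = y 1 := by
    intro y k; simp [he₃]
  have hc2 : ∀ (y : EuclideanSpace ℝ (Fin 3)) (k : ℤ), (y + k • e₃) 2 = y 2 + k := by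
    intro y k; simp [he₃]
  have hwp : ∀ y, y ∉ L → ∀ k : ℤ, w (y + k • e₃) = w y := by
    intro y hy k
    rw [hwe, hwe, hper' y hy, hc0, hc1]
  -- the compact set
  set K : Set (EuclideanSpace ℝ (Fin 3)) :=
    {y | y 0 ^ 2 + y 1 ^ 2 ≤ R ∧ 0 ≤ y 2 ∧ y 2 ≤ 1 ∧ ∀ q ∈ L, s ≤ dist y q} with hK
  have hKL : ∀ y ∈ K, y ∉ L := fun y hy hyL => by
    have := hy.2.2.2 y hyL
    rw [dist_self] at this; linarith
  have hKc : IsCompact K := by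
    refine Metric.isCompact_of_isClosed_isBounded ?_ ?_
    · have h4 : IsClosed {y : EuclideanSpace ℝ (Fin 3) | ∀ q ∈ L, s ≤ dist y q} := by
        simp only [ofPred_forall]
        exact isClosed_biInter fun q _ => isClosed_le continuous_const (by fun_prop)
      have h1 : IsClosed {y : EuclideanSpace ℝ (Fin 3) | y 0 ^ 2 + y 1 ^ 2 ≤ R} :=
        isClosed_le (by fun_prop) continuous_const
      have h2 : IsClosed {y : EuclideanSpace ℝ (Fin 3) | 0 ≤ y 2} :=
        isClosed_le continuous_const (by fun_prop)
      have h3 : IsClosed {y : EuclideanSpace ℝ (Fin 3) | y 2 ≤ 1} :=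
        isClosed_le (by fun_prop) continuous_const
      exact h1.inter (h2.inter (h3.inter h4))
    · refine (Metric.isBounded_closedBall (x := (0 : EuclideanSpace ℝ (Fin 3)))
        (r := Real.sqrt (R + 1))).subset fun y hy => ?_
      rw [Metric.mem_closedBall, aux_dist_sq]
      apply Real.sqrt_le_sqrt
      have := hy.1
      have h2 := hy.2.1
      have h3 := hy.2.2.1
      simp
      nlinarith
  have hclaim : ∀ y, y ∉ L → y 0 ^ 2 + y 1 ^ 2 ≤ R → ∃ z ∈ K, w y ≤ w z := by
    intro y hy hyR
    obtain ⟨z, hz1, hz2, hz3⟩ : ∃ z : EuclideanSpace ℝ (Fin 3),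
        z 0 ^ 2 + z 1 ^ 2 ≤ R ∧ (∀ q ∈ L, s ≤ dist z q) ∧ w y ≤ w z := by
      by_cases hd : ∀ q ∈ L, s ≤ dist y q
      · exact ⟨y, hyR, hd, le_rfl⟩
      · push Not at hd
        obtain ⟨q, hq, hyq⟩ := hd
        have hball : ∀ z, z ≠ q → dist z q ≤ s → z ∉ L := by
          intro z hzq hzs hzL
          have := hsep z hzL q hq hzq
          linarith
        obtain ⟨z, hz, hyz⟩ := aux_stepA (w := w) (q := q) (s := s) (C := C) (μ := μ)
          (B := η * (2 * M + 2 * s ^ 2)) hμ (fun z h1 h2 => hwc z (hball z h1 h2))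
          (fun z h1 h2 => hwl z (hball z h1 h2)) (fun z h1 h2 => by
            rw [hwe]
            have h3 := hbound q hq z (hball z h1 h2) h2
            have h4 := mul_le_mul_of_nonneg_left (aux_rho_ball (hM q hq) h2) hη.le
            linarith)
          (x := y) (fun h => hy (h ▸ hq)) hyq
        refine ⟨z, (aux_rho_ball (hM q hq) hz.le).trans hRM, fun q' hq' => ?_, hyz⟩
        by_cases hqq : q = q'
        · rw [← hqq, hz]
        · have h1 := hsep q hq q' hq' hqq
          have h2 := dist_triangle_left q q' z
          linarith
    have hzL : z ∉ L := fun h => by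
      have := hz2 z h
      rw [dist_self] at this; linarith
    refine ⟨z + (-⌊z 2⌋) • e₃, ⟨?_, ?_, ?_, ?_⟩, ?_⟩
    · rwa [hc0, hc1]
    · rw [hc2]; push_cast; linarith [Int.floor_le (z 2)]
    · rw [hc2]; push_cast; linarith [Int.lt_floor_add_one (z 2)]
    · intro q hq
      have h1 := hz2 (q + ⌊z 2⌋ • e₃) (by rwa [hLt])
      have h2 : dist (z + (-⌊z 2⌋) • e₃) q = dist z (q + ⌊z 2⌋ • e₃) := by
        rw [dist_eq_norm, dist_eq_norm]
        congr 1
        rw [neg_smul]; abel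
      rwa [h2]
    · rwa [hwp z hzL]
  obtain ⟨z₁, hz₁, -⟩ := hclaim x hx hRx
  obtain ⟨x₀, hx₀, hmax⟩ := hKc.exists_isMaxOn ⟨z₁, hz₁⟩ (f := w)
    (fun y hy => (hwc y (hKL y hy)).continuousAt.continuousWithinAt)
  have hglob : ∀ y, y ∉ L → y 0 ^ 2 + y 1 ^ 2 ≤ R → w y ≤ w x₀ := by
    intro y hy hyR
    obtain ⟨z, hz, hyz⟩ := hclaim y hy hyR
    exact hyz.trans (hmax hz)
  have hx₀L := hKL x₀ hx₀
  have hge : R ≤ x₀ 0 ^ 2 + x₀ 1 ^ 2 := by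
    by_contra! hlt
    have hloc : IsLocalMax w x₀ := by
      have h1 : ∀ᶠ y in 𝓝 x₀, y 0 ^ 2 + y 1 ^ 2 < R :=
        (aux_rho_contDiff x₀).continuousAt.eventually_lt continuousAt_const hlt
      filter_upwards [h1, hLc.isOpen_compl.mem_nhds hx₀L] with y hy hyL
      exact hglob y hyL hy.le
    exact absurd (aux_max (hwc x₀ hx₀L) hloc) (not_le.2 (hwl x₀ hx₀L))
  have h1 := hglob x hx hRx
  rw [hwe, hwe] at h1
  have h2 := hR₁ x₀ hx₀L (hRR₁.trans hge)
  have h3 := mul_le_mul_of_nonneg_left hx₀.1 hη.le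
  have h4 : 0 ≤ η * (x 0 ^ 2 + x 1 ^ 2) := by positivity
  linarith

/-- **Liouville on ℝ² × S¹ minus monopole points.** Let P = {p₁,…,p_m} ⊂ ℝ³
with pairwise distinct translates P + ℤe₃, e₃ = (0,0,1). If u is harmonic on
ℝ³ ∖ (P + ℤe₃), 1-periodic in the e₃-direction, satisfies |u(x)| ≤ C·|x − q|^{−μ}
(0 < μ < 1) near every q ∈ P + ℤe₃, and u(x) → 0 as x₁² + x₂² → ∞, then u ≡ 0 on
ℝ³ ∖ (P + ℤe₃). -/
theorem stmt_9 (m : ℕ) (P : Fin m → EuclideanSpace ℝ (Fin 3))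
    (e₃ : EuclideanSpace ℝ (Fin 3))
    (he₃ : e₃ = EuclideanSpace.single (2 : Fin 3) (1 : ℝ))
    (L : Set (EuclideanSpace ℝ (Fin 3)))
    (hL : L = Set.range (fun q : Fin m × ℤ => P q.1 + q.2 • e₃))
    (hinj : Function.Injective (fun q : Fin m × ℤ => P q.1 + q.2 • e₃))
    (u : EuclideanSpace ℝ (Fin 3) → ℝ)
    (hu : IsHarmonicOnEuc u Lᶜ)
    (hper : ∀ x, x ∉ L → u (x + e₃) = u x)
    (s₀ : ℝ) (hs₀ : 0 < s₀) (C : ℝ) (hC : 0 < C) (μ : ℝ) (hμ : μ ∈ Set.Ioo (0 : ℝ) 1)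
    (hbound : ∀ q ∈ L, ∀ x, x ∉ L → dist x q < s₀ → |u x| ≤ C * (dist x q) ^ (-μ))
    (hdecay : ∀ ε : ℝ, 0 < ε → ∃ R : ℝ, ∀ x, x ∉ L →
      R ≤ (x 0) ^ 2 + (x 1) ^ 2 → |u x| ≤ ε) :
    ∀ x, x ∉ L → u x = 0 := by
  have hn : ‖e₃‖ = 1 := by simp [he₃]
  have hLt : ∀ x, ∀ k : ℤ, x + k • e₃ ∈ L ↔ x ∈ L := by
    have key : ∀ x, ∀ k : ℤ, x ∈ L → x + k • e₃ ∈ L := by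
      intro x k hx
      rw [hL] at hx ⊢
      obtain ⟨⟨j, l⟩, rfl⟩ := hx
      exact ⟨(j, l + k), by simp only [add_smul, add_assoc]⟩
    intro x k
    refine ⟨fun h => ?_, key x k⟩
    have := key _ (-k) h
    simpa using this
  have hsub : ∀ i, ∀ T : Set (EuclideanSpace ℝ (Fin 3)),
      IsClosed (range (fun k : ℤ => P i + k • e₃) ∩ T) := by
    intro i T
    refine Metric.isClosed_of_pairwise_le_dist one_pos ?_
    rintro _ ⟨⟨k, rfl⟩, -⟩ _ ⟨⟨l, rfl⟩, -⟩ hkl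
    have hne : k ≠ l := fun h => hkl (by rw [h])
    simp only [dist_add_left]
    rw [dist_eq_norm, ← sub_smul, ← Int.cast_smul_eq_zsmul ℝ, norm_smul, hn, mul_one]
    have : (1 : ℝ) ≤ |((k - l : ℤ) : ℝ)| := by
      exact_mod_cast Int.one_le_abs (sub_ne_zero.2 hne)
    exact this
  have hLU : ∀ T : Set (EuclideanSpace ℝ (Fin 3)), IsClosed (L ∩ T) := by
    intro T
    have : L ∩ T = ⋃ i, (range (fun k : ℤ => P i + k • e₃) ∩ T) := by
      rw [hL]
      ext y
      simp
    rw [this]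
    exact isClosed_iUnion_of_finite fun i => hsub i T
  have hLc : IsClosed L := by simpa using hLU univ
  have hsj : ∀ j, ∀ᶠ s in 𝓝[>] (0 : ℝ), ∀ p ∈ L, p ≠ P j → 2 * s ≤ dist p (P j) := by
    intro j
    have h1 : (L ∩ {P j}ᶜ)ᶜ ∈ 𝓝 (P j) := (hLU _).isOpen_compl.mem_nhds (by simp)
    obtain ⟨r, hr, hball⟩ := Metric.mem_nhds_iff.1 h1
    filter_upwards [Ioo_mem_nhdsGT (show (0:ℝ) < r / 2 by linarith)] with s hs p hp hpj
    by_contra! hlt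
    have hlt' : dist p (P j) < r := by linarith [hs.2]
    exact hball hlt' ⟨hp, hpj⟩
  obtain ⟨s, ⟨hall, hs⟩⟩ := ((eventually_all.2 hsj).and
    (Ioo_mem_nhdsGT hs₀ : ∀ᶠ s in 𝓝[>] (0 : ℝ), s ∈ Ioo 0 s₀)).exists
  have hsep : ∀ p ∈ L, ∀ q ∈ L, p ≠ q → 2 * s ≤ dist p q := by
    intro p hp q hq hpq
    have hq' := hq
    rw [hL] at hq'
    obtain ⟨⟨j, k⟩, rfl⟩ := hq'
    have := hall j (p + (-k) • e₃) (by rwa [hLt]) (fun h => hpq (by simp only [← h]; simp))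
    have h2 : dist (p + (-k) • e₃) (P j) = dist p (P j + k • e₃) := by
      rw [dist_eq_norm, dist_eq_norm]
      congr 1
      rw [neg_smul]; abel
    rwa [h2] at this
  have hM : ∀ q ∈ L, q 0 ^ 2 + q 1 ^ 2 ≤ ∑ j, (P j 0 ^ 2 + P j 1 ^ 2) := by
    intro q hq
    rw [hL] at hq
    obtain ⟨⟨j, k⟩, rfl⟩ := hq
    have := Finset.single_le_sum (f := fun j => P j 0 ^ 2 + P j 1 ^ 2)
      (fun i _ => by positivity) (Finset.mem_univ j)
    simpa [he₃] using this
  have hu' : ∀ x, x ∉ L → ContDiffAt ℝ 2 u x ∧ Δ u x = 0 := by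
    intro x hx
    refine ⟨hu.1.contDiffAt (hLc.isOpen_compl.mem_nhds hx), ?_⟩
    rw [aux_lap, ← hu.2 x hx]
    exact Finset.sum_congr rfl fun i _ => by
      rw [iteratedFDerivWithin_of_isOpen 2 hLc.isOpen_compl hx]
  intro x hx
  refine le_antisymm ?_ ?_
  · refine aux_main L e₃ he₃ hLt s hs.1 hsep _ hM u hu' hper C μ hμ.2 ?_ ?_ x hx
    · intro q hq y hy hyq
      exact (le_abs_self _).trans (hbound q hq y hy (hyq.trans_lt hs.2))
    · intro ε hε
      obtain ⟨R, hR⟩ := hdecay ε hε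
      exact ⟨R, fun y hy h => (le_abs_self _).trans (hR y hy h)⟩
  · have := aux_main L e₃ he₃ hLt s hs.1 hsep _ hM (-u)
      (fun y hy => ⟨(hu' y hy).1.neg, by rw [laplacian_neg]; simp [(hu' y hy).2]⟩)
      (fun y hy => by simp [hper y hy]) C μ hμ.2 ?_ ?_ x hx
    · simpa using this
    · intro q hq y hy hyq
      exact (neg_le_abs _).trans (hbound q hq y hy (hyq.trans_lt hs.2))
    · intro ε hε
      obtain ⟨R, hR⟩ := hdecay ε hε
      exact ⟨R, fun y hy h => (neg_le_abs _).trans (hR y hy h)⟩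
end

section
/- Let n ≥ 2, r₀ > 0, ℵ > 1, and let Ω = {x ∈ ℝⁿ : x₁ > r₀}. Let (a_{ij})_{1 ≤ i,j ≤ n} be smooth real-valued functions on Ω with a_{ij} = −a_{ji}, satisfying the closedness condition ∂_i a_{jk} + ∂_j a_{ki} + ∂_k a_{ij} = 0 on Ω for all i, j, k, and suppose that for every multi-index α there is a constant C_α such that |∂^α a_{ij}(x)| ≤ C_α · x₁^{−ℵ−|α|} for all x ∈ Ω and all i, j. Then there exist smooth real-valued functions (b_i)_{1 ≤ i ≤ n} on Ω such that ∂_i b_j − ∂_j b_i = a_{ij} on Ω for all i, j, and for every multi-index α there is a constant C'_α with |∂^α b_i(x)| ≤ C'_α · x₁^{1−ℵ−|α|} for all x ∈ Ω and all i. (One may take b₁ = 0 and b_i(x) = −∫_{x₁}^{∞} a_{1i}(t, x₂, …, x_n) dt for i ≥ 2.) -/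
open Set Filter Topology MeasureTheory

section helpers

variable {E : Type} [NormedAddCommGroup E] [NormedSpace ℝ E]
variable {F : Type} [NormedAddCommGroup F] [NormedSpace ℝ F]

def HS (l : E →L[ℝ] ℝ) (r : ℝ) : Set E := {x | r < l x}

def GoodDecay (l : E →L[ℝ] ℝ) (r s : ℝ) (f : E → F) : Prop :=
  ContDiffOn ℝ (⊤ : ℕ∞) f (HS l r) ∧ ∀ k : ℕ, ∃ C : ℝ, ∀ x ∈ HS l r,
    ‖iteratedFDerivWithin ℝ k f (HS l r) x‖ ≤ C * (l x) ^ (-s - (k : ℝ))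

noncomputable def tailInt (e : E) (f : E → F) (x : E) : F := ∫ t in Ioi (0 : ℝ), f (x + t • e)

theorem HS_open (l : E →L[ℝ] ℝ) (r : ℝ) : IsOpen (HS l r) :=
  isOpen_lt continuous_const l.continuous

theorem HS_shift {l : E →L[ℝ] ℝ} {r : ℝ} {e : E} (he : l e = 1) {x : E} (hx : x ∈ HS l r)
    {t : ℝ} (ht : 0 ≤ t) : x + t • e ∈ HS l r := by
  simp only [HS, mem_ofPred_eq, map_add, map_smul, he, smul_eq_mul, mul_one] at *
  linarith

theorem GoodDecay.fderivW {l : E →L[ℝ] ℝ} {r s : ℝ} {f : E → F} (h : GoodDecay l r s f) :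
    GoodDecay l r (s + 1) (fderivWithin ℝ f (HS l r)) := by
  refine ⟨h.1.fderivWithin (HS_open l r).uniqueDiffOn (by simp), fun k => ?_⟩
  obtain ⟨C, hC⟩ := h.2 (k + 1)
  refine ⟨C, fun x hx => ?_⟩
  rw [norm_iteratedFDerivWithin_fderivWithin (HS_open l r).uniqueDiffOn hx]
  refine (hC x hx).trans_eq ?_
  congr 2
  push_cast
  ring

theorem GoodDecay.bound {l : E →L[ℝ] ℝ} {r s : ℝ} {f : E → F} (hr : 0 < r)
    (h : GoodDecay l r s f) :
    ∃ C, 0 ≤ C ∧ ∀ x ∈ HS l r, ‖f x‖ ≤ C * (l x) ^ (-s) := by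
  obtain ⟨C, hC⟩ := h.2 0
  refine ⟨|C|, abs_nonneg _, fun x hx => ?_⟩
  have := hC x hx
  rw [norm_iteratedFDerivWithin_zero] at this
  simp only [Nat.cast_zero, sub_zero] at this
  have h0 : 0 < l x := hr.trans hx
  exact this.trans (mul_le_mul_of_nonneg_right (le_abs_self _) (Real.rpow_nonneg h0.le _))

theorem GoodDecay.bound_shift {l : E →L[ℝ] ℝ} {r s : ℝ} {f : E → F} (hr : 0 < r) {e : E}
    (he : l e = 1) (hs : 0 ≤ s) (h : GoodDecay l r s f) :
    ∃ C, 0 ≤ C ∧ ∀ c, r < c → ∀ x, c ≤ l x → ∀ t, 0 ≤ t →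
      ‖f (x + t • e)‖ ≤ C * (t + c) ^ (-s) := by
  obtain ⟨C, C0, hC⟩ := h.bound hr
  refine ⟨C, C0, fun c hc x hx t ht => ?_⟩
  refine (hC _ (HS_shift he (show r < l x by linarith) ht)).trans ?_
  refine mul_le_mul_of_nonneg_left ?_ C0
  simp only [map_add, map_smul, he, smul_eq_mul, mul_one]
  exact Real.rpow_le_rpow_of_nonpos (by linarith) (by linarith) (by linarith)

theorem GoodDecay.contShift {l : E →L[ℝ] ℝ} {r s : ℝ} {f : E → F} {e : E}
    (he : l e = 1) (h : GoodDecay l r s f) {x : E} (hx : x ∈ HS l r) :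
    ContinuousOn (fun t : ℝ => f (x + t • e)) (Ici 0) :=
  h.1.continuousOn.comp (by fun_prop) (fun _ ht => HS_shift he hx ht)

theorem GoodDecay.aesm {l : E →L[ℝ] ℝ} {r s : ℝ} {f : E → F} {e : E}
    (he : l e = 1) (h : GoodDecay l r s f) {x : E} (hx : x ∈ HS l r) :
    AEStronglyMeasurable (fun t : ℝ => f (x + t • e)) (volume.restrict (Ioi 0)) :=
  ((h.contShift he hx).mono Ioi_subset_Ici_self).aestronglyMeasurable measurableSet_Ioi

theorem GoodDecay.integrable {l : E →L[ℝ] ℝ} {r s : ℝ} {f : E → F} {e : E} (hr : 0 < r)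
    (he : l e = 1) (hs : 1 < s) (h : GoodDecay l r s f) {x : E} (hx : x ∈ HS l r) :
    IntegrableOn (fun t : ℝ => f (x + t • e)) (Ioi 0) := by
  obtain ⟨C, C0, hC⟩ := h.bound_shift hr he (by linarith)
  have h0 : 0 < l x := hr.trans hx
  refine Integrable.mono' ((integrableOn_add_rpow_Ioi_of_lt (a := -s) (m := l x) (c := 0)
    (by linarith) (by linarith)).const_mul C) (h.aesm he hx) ?_
  filter_upwards [ae_restrict_mem measurableSet_Ioi] with t ht
  exact hC (l x) hx x le_rfl t (le_of_lt ht)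

theorem GoodDecay.hasFDerivAt {l : E →L[ℝ] ℝ} {r s : ℝ} {f : E → F} {e : E} (hr : 0 < r)
    (he : l e = 1) (hs : 1 < s) (h : GoodDecay l r s f) {x : E} (hx : x ∈ HS l r) :
    HasFDerivAt (tailInt e f) (tailInt e (fderivWithin ℝ f (HS l r)) x) x := by
  have h' := h.fderivW
  obtain ⟨C, C0, hC⟩ := h'.bound_shift hr he (by linarith)
  obtain ⟨c, hc, hcx⟩ := exists_between (show r < l x from hx)
  unfold tailInt
  refine hasFDerivAt_integral_of_dominated_of_fderiv_le (s := HS l c)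
    (F := fun x (t : ℝ) => f (x + t • e))
    (F' := fun x (t : ℝ) => fderivWithin ℝ f (HS l r) (x + t • e))
    (bound := fun t => C * (t + c) ^ (-(s + 1)))
    ((HS_open l c).mem_nhds hcx) ?_ (h.integrable hr he hs hx) (h'.aesm he hx) ?_ ?_ ?_
  · filter_upwards [(HS_open l r).mem_nhds hx] with y hy
    exact h.aesm he hy
  · filter_upwards [ae_restrict_mem measurableSet_Ioi] with t ht y hy
    exact hC c hc y (le_of_lt hy) t (le_of_lt ht)
  · exact (integrableOn_add_rpow_Ioi_of_lt (by linarith) (by linarith)).const_mul C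
  · filter_upwards [ae_restrict_mem measurableSet_Ioi] with t ht y hy
    have hy' : y + t • e ∈ HS l r := HS_shift he (show r < l y from hc.trans hy) (le_of_lt ht)
    have hd : HasFDerivAt f (fderivWithin ℝ f (HS l r) (y + t • e)) (y + t • e) :=
      ((h.1.differentiableOn (by simp)) _ hy').hasFDerivWithinAt.hasFDerivAt
        ((HS_open l r).mem_nhds hy')
    have h2 : HasFDerivAt (fun y : E => y + t • e) (ContinuousLinearMap.id ℝ E) y :=
      (hasFDerivAt_id y).add_const _
    simpa [Function.comp_def] using hd.comp y h2

theorem GoodDecay.fderivW_tail {l : E →L[ℝ] ℝ} {r s : ℝ} {f : E → F} {e : E} (hr : 0 < r)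
    (he : l e = 1) (hs : 1 < s) (h : GoodDecay l r s f) :
    EqOn (fderivWithin ℝ (tailInt e f) (HS l r)) (tailInt e (fderivWithin ℝ f (HS l r)))
      (HS l r) := fun x hx =>
  (h.hasFDerivAt hr he hs hx).hasFDerivWithinAt.fderivWithin
    ((HS_open l r).uniqueDiffOn x hx)

theorem tail_contDiff {l : E →L[ℝ] ℝ} {r : ℝ} {e : E} (hr : 0 < r)
    (he : l e = 1) (m : ℕ) : ∀ {F : Type} [NormedAddCommGroup F] [NormedSpace ℝ F]
    {s : ℝ} {f : E → F}, 1 < s → GoodDecay l r s f →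
    ContDiffOn ℝ m (tailInt e f) (HS l r) := by
  induction m with
  | zero =>
    intro F _ _ s f hs h
    exact contDiffOn_zero.2
      fun x hx => (h.hasFDerivAt hr he hs hx).continuousAt.continuousWithinAt
  | succ m ih =>
    intro F _ _ s f hs h
    push_cast
    rw [contDiffOn_succ_iff_fderivWithin (HS_open l r).uniqueDiffOn]
    refine ⟨fun x hx => (h.hasFDerivAt hr he hs hx).differentiableAt.differentiableWithinAt,
      by simp, ?_⟩
    exact (ih (by linarith) h.fderivW).congr (h.fderivW_tail hr he hs)

theorem integral_shift_rpow {s c : ℝ} (hs : 1 < s) (hc : 0 < c) :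
    ∫ t in Ioi (0 : ℝ), (t + c) ^ (-s) = c ^ (1 - s) / (s - 1) := by
  have hd : ∀ x ∈ Ici (0 : ℝ), HasDerivAt (fun t : ℝ => (t + c) ^ (1 - s) / (1 - s))
      ((x + c) ^ (-s)) x := by
    intro x hx
    have hx' : 0 ≤ x := hx
    have h1 := (((hasDerivAt_id x).add_const c).rpow_const (p := 1 - s)
      (Or.inl (by simp only [id]; linarith))).div_const (1 - s)
    refine h1.congr_deriv ?_
    have : 1 - s ≠ 0 := by linarith
    have h2 : 1 - s - 1 = -s := by ring
    rw [h2]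
    simp only [id]
    field_simp
  have ht : Tendsto (fun t : ℝ => (t + c) ^ (1 - s) / (1 - s)) atTop (𝓝 (0 / (1 - s))) := by
    refine Tendsto.div_const ?_ _
    have := (tendsto_rpow_neg_atTop (show 0 < s - 1 by linarith)).comp
      (tendsto_atTop_add_const_right atTop c tendsto_id)
    simpa [Function.comp_def] using this
  rw [integral_Ioi_of_hasDerivAt_of_tendsto' hd
    (integrableOn_add_rpow_Ioi_of_lt (by linarith) (by linarith)) ht]
  have : 1 - s ≠ 0 := by linarith
  have : s - 1 ≠ 0 := by linarith
  simp only [zero_add, zero_div, zero_sub]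
  rw [← div_neg, neg_sub]

theorem tail_bound {l : E →L[ℝ] ℝ} {r : ℝ} {e : E} (hr : 0 < r)
    (he : l e = 1) (k : ℕ) : ∀ {F : Type} [NormedAddCommGroup F] [NormedSpace ℝ F]
    {s : ℝ} {f : E → F}, 1 < s → GoodDecay l r s f →
    ∃ C : ℝ, ∀ x ∈ HS l r,
      ‖iteratedFDerivWithin ℝ k (tailInt e f) (HS l r) x‖ ≤ C * (l x) ^ (1 - s - (k : ℝ)) := by
  induction k with
  | zero =>
    intro F _ _ s f hs h
    obtain ⟨C, C0, hC⟩ := h.bound_shift hr he (by linarith)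
    refine ⟨C / (s - 1), fun x hx => ?_⟩
    have h0 : 0 < l x := hr.trans hx
    rw [norm_iteratedFDerivWithin_zero]
    have hI := (integrableOn_add_rpow_Ioi_of_lt (a := -s) (m := l x) (c := 0)
      (by linarith) (by linarith)).const_mul C
    have := norm_integral_le_of_norm_le (f := fun t : ℝ => f (x + t • e)) hI (by
      filter_upwards [ae_restrict_mem measurableSet_Ioi] with t ht
      exact hC (l x) hx x le_rfl t (le_of_lt ht))
    refine this.trans_eq ?_
    rw [integral_const_mul, integral_shift_rpow hs h0]
    simp only [Nat.cast_zero, sub_zero]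
    ring
  | succ k ih =>
    intro F _ _ s f hs h
    obtain ⟨C, hC⟩ := ih (show 1 < s + 1 by linarith) h.fderivW
    refine ⟨C, fun x hx => ?_⟩
    rw [← norm_iteratedFDerivWithin_fderivWithin (HS_open l r).uniqueDiffOn hx,
      iteratedFDerivWithin_congr (h.fderivW_tail hr he hs) hx]
    refine (hC x hx).trans_eq ?_
    congr 2
    push_cast
    ring

theorem tail_deriv [CompleteSpace F] {l : E →L[ℝ] ℝ} {r s : ℝ} {f : E → F} {e : E} (hr : 0 < r)
    (he : l e = 1) (hs : 1 < s) (h : GoodDecay l r s f) {x : E} (hx : x ∈ HS l r) :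
    ∫ t in Ioi (0 : ℝ), fderivWithin ℝ f (HS l r) (x + t • e) e = - f x := by
  have h0 : 0 < l x := hr.trans hx
  have hd : ∀ t ∈ Ici (0 : ℝ), HasDerivAt (fun t : ℝ => f (x + t • e))
      (fderivWithin ℝ f (HS l r) (x + t • e) e) t := by
    intro t ht
    have hy' : x + t • e ∈ HS l r := HS_shift he hx ht
    have hd : HasFDerivAt f (fderivWithin ℝ f (HS l r) (x + t • e)) (x + t • e) :=
      ((h.1.differentiableOn (by simp)) _ hy').hasFDerivWithinAt.hasFDerivAt
        ((HS_open l r).mem_nhds hy')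
    have h2 : HasDerivAt (fun t : ℝ => x + t • e) e t := by
      simpa using ((hasDerivAt_id t).smul_const e).const_add x
    exact hd.comp_hasDerivAt t h2
  have hT : Tendsto (fun t : ℝ => f (x + t • e)) atTop (𝓝 0) := by
    obtain ⟨C, C0, hC⟩ := h.bound_shift hr he (by linarith)
    have h1 : Tendsto (fun t : ℝ => C * (t + l x) ^ (-s)) atTop (𝓝 (C * 0)) :=
      ((tendsto_rpow_neg_atTop (show 0 < s by linarith)).comp
        (tendsto_atTop_add_const_right atTop (l x) tendsto_id)).const_mul C
    rw [mul_zero] at h1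
    refine squeeze_zero_norm' ?_ h1
    filter_upwards [eventually_ge_atTop 0] with t ht
    exact hC (l x) hx x le_rfl t ht
  have hI : IntegrableOn (fun t : ℝ => fderivWithin ℝ f (HS l r) (x + t • e) e) (Ioi 0) :=
    (ContinuousLinearMap.apply ℝ F e).integrable_comp
      (h.fderivW.integrable hr he (by linarith) hx)
  rw [integral_Ioi_of_hasDerivAt_of_tendsto' hd hI hT]
  simp

theorem tail_fderiv_apply [CompleteSpace F] {l : E →L[ℝ] ℝ} {r s : ℝ} {f : E → F} {e : E}
    (hr : 0 < r) (he : l e = 1) (hs : 1 < s) (h : GoodDecay l r s f) {x : E} (hx : x ∈ HS l r)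
    (v : E) :
    fderivWithin ℝ (tailInt e f) (HS l r) x v =
      ∫ t in Ioi (0 : ℝ), fderivWithin ℝ f (HS l r) (x + t • e) v := by
  rw [h.fderivW_tail hr he hs hx]
  exact ContinuousLinearMap.integral_apply (h.fderivW.integrable hr he (by linarith) hx) v

end helpers


/-- **primitive of a decaying closed 2-form on a half-space end.**
Let n ≥ 2, r₀ > 0, ℵ > 1, Ω = {x ∈ ℝⁿ : x₁ > r₀}, and let (a_{ij}) be smooth,
antisymmetric, closed (∂ᵢa_{jk} + ∂ⱼa_{ki} + ∂ₖa_{ij} = 0) on Ω, with all derivatives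
of order k bounded by constants times x₁^{−ℵ−k}. Then there are smooth functions bᵢ on Ω
with ∂ᵢbⱼ − ∂ⱼbᵢ = a_{ij} on Ω whose order-k derivatives are O(x₁^{1−ℵ−k}). -/
theorem stmt_11 (n : ℕ) (hn : 2 ≤ n) (r₀ aleph : ℝ) (hr₀ : 0 < r₀) (haleph : 1 < aleph)
    (Ω : Set (EuclideanSpace ℝ (Fin n)))
    (hΩ : Ω = {x : EuclideanSpace ℝ (Fin n) | r₀ < x ⟨0, by omega⟩})
    (a : Fin n → Fin n → (EuclideanSpace ℝ (Fin n) → ℝ))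
    (hsmooth : ∀ i j, ContDiffOn ℝ (⊤ : ℕ∞) (a i j) Ω)
    (hanti : ∀ i j, ∀ x ∈ Ω, a i j x = - a j i x)
    (hclosed : ∀ i j k : Fin n, ∀ x ∈ Ω,
      fderivWithin ℝ (a j k) Ω x (EuclideanSpace.single i 1) +
      fderivWithin ℝ (a k i) Ω x (EuclideanSpace.single j 1) +
      fderivWithin ℝ (a i j) Ω x (EuclideanSpace.single k 1) = 0)
    (hdecay : ∀ k : ℕ, ∃ C : ℝ, ∀ i j, ∀ x ∈ Ω,
      ‖iteratedFDerivWithin ℝ k (a i j) Ω x‖ ≤ C * (x ⟨0, by omega⟩) ^ (-aleph - (k : ℝ))) :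
    ∃ b : Fin n → (EuclideanSpace ℝ (Fin n) → ℝ),
      (∀ i, ContDiffOn ℝ (⊤ : ℕ∞) (b i) Ω) ∧
      (∀ i j : Fin n, ∀ x ∈ Ω,
        fderivWithin ℝ (b j) Ω x (EuclideanSpace.single i 1) -
        fderivWithin ℝ (b i) Ω x (EuclideanSpace.single j 1) = a i j x) ∧
      (∀ k : ℕ, ∃ C : ℝ, ∀ i, ∀ x ∈ Ω,
        ‖iteratedFDerivWithin ℝ k (b i) Ω x‖ ≤ C * (x ⟨0, by omega⟩) ^ (1 - aleph - (k : ℝ))) := by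
  have hpos : 0 < n := by omega
  set z : Fin n := ⟨0, hpos⟩ with hz
  let l : EuclideanSpace ℝ (Fin n) →L[ℝ] ℝ := EuclideanSpace.proj z
  let e : EuclideanSpace ℝ (Fin n) := EuclideanSpace.single z 1
  have he : l e = 1 := by simp [l, e]
  have hΩ' : Ω = HS l r₀ := hΩ
  have hg : ∀ i j, GoodDecay l r₀ aleph (a i j) := by
    intro i j
    rw [hΩ'] at hsmooth hdecay
    refine ⟨hsmooth i j, fun k => ?_⟩
    obtain ⟨C, hC⟩ := hdecay k
    exact ⟨C, fun x hx => hC i j x hx⟩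
  clear hΩ
  subst hΩ'
  have hu : UniqueDiffOn ℝ (HS l r₀) := (HS_open l r₀).uniqueDiffOn
  refine ⟨fun i x => - tailInt e (a z i) x, fun i => ?_, fun i j x hx => ?_, fun k => ?_⟩
  · exact (contDiffOn_infty.2 fun m => tail_contDiff hr₀ he m haleph (hg z i)).neg
  · rw [fderivWithin_fun_neg (hu x hx), fderivWithin_fun_neg (hu x hx)]
    simp only [neg_apply]
    rw [tail_fderiv_apply hr₀ he haleph (hg z j) hx, tail_fderiv_apply hr₀ he haleph (hg z i) hx]
    have hI : ∀ p q (v : EuclideanSpace ℝ (Fin n)), IntegrableOn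
        (fun t : ℝ => fderivWithin ℝ (a p q) (HS l r₀) (x + t • e) v) (Ioi 0) := fun p q v =>
      (ContinuousLinearMap.apply ℝ ℝ v).integrable_comp
        ((hg p q).fderivW.integrable hr₀ he (by linarith) hx)
    have hD := tail_deriv hr₀ he haleph (hg i j) hx
    have hk : ∫ t in Ioi (0 : ℝ), fderivWithin ℝ (a i j) (HS l r₀) (x + t • e) e =
        ∫ t in Ioi (0 : ℝ), (fderivWithin ℝ (a z j) (HS l r₀) (x + t • e) (EuclideanSpace.single i 1)
          - fderivWithin ℝ (a z i) (HS l r₀) (x + t • e) (EuclideanSpace.single j 1)) := by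
      refine setIntegral_congr_fun measurableSet_Ioi fun t ht => ?_
      have hy := HS_shift he hx (le_of_lt ht)
      have h1 := hclosed i j z _ hy
      have h2 : fderivWithin ℝ (a j z) (HS l r₀) (x + t • e)
          = - fderivWithin ℝ (a z j) (HS l r₀) (x + t • e) := by
        rw [← fderivWithin_fun_neg (hu _ hy)]
        exact fderivWithin_congr (fun y hy => hanti j z y hy) (hanti j z _ hy)
      rw [h2] at h1
      simp only [neg_apply] at h1
      simp only [e] at h1 ⊢
      linarith
    rw [integral_sub (hI z j _) (hI z i _)] at hk
    linarith
  · choose C hC using fun i => tail_bound hr₀ he k haleph (hg z i)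
    refine ⟨∑ i, |C i|, fun i x hx => ?_⟩
    have h0 : 0 < l x := hr₀.trans hx
    have hn : iteratedFDerivWithin ℝ k (fun x => - tailInt e (a z i) x) (HS l r₀) x =
        - iteratedFDerivWithin ℝ k (tailInt e (a z i)) (HS l r₀) x :=
      iteratedFDerivWithin_neg_apply hu hx
    rw [hn, norm_neg]
    refine (hC i x hx).trans (mul_le_mul_of_nonneg_right ?_ (Real.rpow_nonneg h0.le _))
    exact (le_abs_self _).trans
      (Finset.single_le_sum (f := fun i => |C i|) (fun _ _ => abs_nonneg _) (Finset.mem_univ i))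
end
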